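/- arXiv:math/0601611 — 2 statements merged into one kernel-verified Lean document; each statement's English description precedes it below -/
import Mathlib

section
/- Under the geometrical assumption, there exist T > 0 and a unique solution φ_eik ∈ C^∞([0,T] × ℝ^n; ℝ) of the eikonal equation ∂_t φ_eik + (1/2)|∇_x φ_eik|² + V(t,x) = 0 with φ_eik(0,·) = φ0; moreover this solution is subquadratic: for every multi-index α with |α| ≥ 2, ∂_x^α φ_eik ∈ L^∞([0,T] × ℝ^n). -/
open MeasureTheory Real Filter Set

noncomputable section

/-- Euclidean space ℝⁿ. -/
abbrev Esp (n : ℕ) := EuclideanSpace ℝ (Fin n)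

/-- `i`-th standard basis vector. -/
def evec (n : ℕ) (i : Fin n) : Esp n := EuclideanSpace.single i 1

/-- Partial derivative in the `i`-th coordinate direction. -/
def pd {n : ℕ} {F : Type*} [NormedAddCommGroup F] [NormedSpace ℝ F]
    (f : Esp n → F) (i : Fin n) (x : Esp n) : F :=
  fderiv ℝ f x (evec n i)

/-- Laplacian in the space variable. -/
def lap {n : ℕ} {F : Type*} [NormedAddCommGroup F] [NormedSpace ℝ F]
    (f : Esp n → F) (x : Esp n) : F :=
  ∑ i, pd (fun y => pd f i y) i x

/-- `∇φ·∇a` for a real-valued `φ` and a complex-valued `a` (componentwise). -/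
def gdotC {n : ℕ} (φ : Esp n → ℝ) (a : Esp n → ℂ) (x : Esp n) : ℂ :=
  ∑ i, ((pd φ i x : ℝ) : ℂ) * pd a i x

/-- `∇φ·∇ψ` for real-valued functions. -/
def gdotR {n : ℕ} (φ ψ : Esp n → ℝ) (x : Esp n) : ℝ :=
  ∑ i, pd φ i x * pd ψ i x

/-- Jacobian determinant of a map ℝⁿ → ℝⁿ. -/
def jacDet {n : ℕ} (g : Esp n → Esp n) (y : Esp n) : ℝ :=
  LinearMap.det ((fderiv ℝ g y) : Esp n →ₗ[ℝ] Esp n)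

/-- Square of the Sobolev `H^s` norm (via iterated derivatives). -/
def HsNormSq {n : ℕ} {F : Type*} [NormedAddCommGroup F] [NormedSpace ℝ F]
    (s : ℕ) (w : Esp n → F) : ℝ :=
  ∑ k ∈ Finset.range (s + 1), ∫ x, ‖iteratedFDeriv ℝ k w x‖ ^ 2

/-- Sobolev `H^s` norm. -/
def HsNorm {n : ℕ} {F : Type*} [NormedAddCommGroup F] [NormedSpace ℝ F]
    (s : ℕ) (w : Esp n → F) : ℝ :=
  Real.sqrt (HsNormSq s w)

/-- Membership in the Sobolev space `H^s`. -/
def InHs {n : ℕ} {F : Type*} [NormedAddCommGroup F] [NormedSpace ℝ F]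
    (s : ℕ) (w : Esp n → F) : Prop :=
  ContDiff ℝ s w ∧ ∀ k ≤ s, Integrable (fun x => ‖iteratedFDeriv ℝ k w x‖ ^ 2)

/-- Membership in `H^s` for all `s` (i.e. in `H^∞`). -/
def InHinf {n : ℕ} {F : Type*} [NormedAddCommGroup F] [NormedSpace ℝ F]
    (w : Esp n → F) : Prop :=
  ContDiff ℝ (⊤ : ℕ∞) w ∧ ∀ s : ℕ, InHs s w

/-- `t ↦ a t` is continuous with values in `H^s` on `[0,T]`. -/
def ContHs {n : ℕ} {F : Type*} [NormedAddCommGroup F] [NormedSpace ℝ F]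
    (T : ℝ) (s : ℕ) (a : ℝ → Esp n → F) : Prop :=
  (∀ t ∈ Icc (0:ℝ) T, InHs s (a t)) ∧
  ∀ t₀ ∈ Icc (0:ℝ) T, Tendsto (fun t => HsNorm s (fun x => a t x - a t₀ x))
    (nhdsWithin t₀ (Icc (0:ℝ) T)) (nhds 0)

/-- The `L² ∩ L^∞` norm. -/
def L2LinfNorm {n : ℕ} {F : Type*} [NormedAddCommGroup F] [NormedSpace ℝ F]
    (w : Esp n → F) : ℝ :=
  (eLpNorm w 2 volume).toReal + (eLpNorm w ⊤ volume).toReal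

/-- Smoothness on the time slab `[0,T] × ℝⁿ`. -/
def SmoothOnSlab {n : ℕ} {F : Type*} [NormedAddCommGroup F] [NormedSpace ℝ F]
    (T : ℝ) (u : ℝ → Esp n → F) : Prop :=
  ContDiffOn ℝ (⊤ : ℕ∞) (fun p : ℝ × Esp n => u p.1 p.2) (Icc (0:ℝ) T ×ˢ univ)

/-- All spatial derivatives of `φ` of order `≥ 2` are bounded on `[0,T] × ℝⁿ`. -/
def SubquadSlab {n : ℕ} (T : ℝ) (φ : ℝ → Esp n → ℝ) : Prop :=
  ∀ k : ℕ, 2 ≤ k → ∃ C, ∀ t ∈ Icc (0:ℝ) T, ∀ x, ‖iteratedFDeriv ℝ k (φ t) x‖ ≤ C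

/-- Geometrical assumption: smooth subquadratic potential and initial phase. -/
structure GeomAssump (n : ℕ) (V : ℝ → Esp n → ℝ) (φ0 : Esp n → ℝ) : Prop where
  smoothV : ContDiff ℝ (⊤ : ℕ∞) (fun p : ℝ × Esp n => V p.1 p.2)
  subquadV : ∀ k : ℕ, 2 ≤ k → ∀ R > (0:ℝ), ∃ C, ∀ t : ℝ, |t| ≤ R → ∀ x,
    ‖iteratedFDeriv ℝ k (V t) x‖ ≤ C
  smoothφ0 : ContDiff ℝ (⊤ : ℕ∞) φ0
  subquadφ0 : ∀ k : ℕ, 2 ≤ k → ∃ C, ∀ x, ‖iteratedFDeriv ℝ k φ0 x‖ ≤ C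

/-- `φ` is a smooth solution on `[0,T] × ℝⁿ` of the eikonal equation
`∂_t φ + (1/2)|∇φ|² + V = 0`, `φ(0,·) = φ0`. -/
structure IsEikSol {n : ℕ} (V : ℝ → Esp n → ℝ) (φ0 : Esp n → ℝ)
    (T : ℝ) (φ : ℝ → Esp n → ℝ) : Prop where
  smooth : SmoothOnSlab T φ
  eq : ∀ t ∈ Icc (0:ℝ) T, ∀ x,
    deriv (fun s => φ s x) t + (1/2) * gdotR (φ t) (φ t) x + V t x = 0
  init : ∀ x, φ 0 x = φ0 x

/-- The Hamiltonian flow of `H = τ + |ξ|²/2 + V(t,x)` issued from `(y, ∇φ0(y))`. -/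
structure IsHamFlow {n : ℕ} (V : ℝ → Esp n → ℝ) (φ0 : Esp n → ℝ)
    (X Ξ : ℝ → Esp n → Esp n) : Prop where
  init_x : ∀ y, X 0 y = y
  init_xi : ∀ y, Ξ 0 y = gradient φ0 y
  dx : ∀ t y, HasDerivAt (fun s => X s y) (Ξ t y) t
  dxi : ∀ t y, HasDerivAt (fun s => Ξ s y) (-(gradient (V t) (X t y))) t

/-- Analytical assumption: smooth nonlinearity, initial amplitudes converging in every `H^s`. -/
structure AnalAssump (n : ℕ) (f : ℝ → ℝ) (a0e : ℝ → Esp n → ℂ) (a0 : Esp n → ℂ) : Prop where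
  smoothf : ContDiff ℝ (⊤ : ℕ∞) f
  a0_Hinf : InHinf a0
  conv : ∀ s : ℕ, Tendsto (fun ε => HsNorm s (fun x => a0e ε x - a0 x))
    (nhdsWithin 0 (Ioi 0)) (nhds 0)


/-! ### Nemytskii (superposition) operators on `C(K, G)` -/

section Nemytskii

variable {K : Type} [TopologicalSpace K] [CompactSpace K]
variable {G : Type} [NormedAddCommGroup G] [NormedSpace ℝ G]
variable {H : Type} [NormedAddCommGroup H] [NormedSpace ℝ H]

/-- Copy of the space of operators, whose topology is (syntactically) the norm topology. -/
def Op (G : Type) [NormedAddCommGroup G] [NormedSpace ℝ G]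
    (H : Type) [NormedAddCommGroup H] [NormedSpace ℝ H] := G →L[ℝ] H

instance : NormedAddCommGroup (Op G H) := inferInstanceAs (NormedAddCommGroup (G →L[ℝ] H))
instance : NormedSpace ℝ (Op G H) := inferInstanceAs (NormedSpace ℝ (G →L[ℝ] H))

/-- The identity map from `Op G H` to operators. -/
def Op.out (G : Type) [NormedAddCommGroup G] [NormedSpace ℝ G]
    (H : Type) [NormedAddCommGroup H] [NormedSpace ℝ H] : Op G H →L[ℝ] (G →L[ℝ] H) :=
  ContinuousLinearMap.id ℝ (G →L[ℝ] H)

/-- The identity map from operators to `Op G H`. -/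
def Op.mk (G : Type) [NormedAddCommGroup G] [NormedSpace ℝ G]
    (H : Type) [NormedAddCommGroup H] [NormedSpace ℝ H] : (G →L[ℝ] H) →L[ℝ] Op G H :=
  ContinuousLinearMap.id ℝ (G →L[ℝ] H)

@[simp] lemma Op.out_mk (A : G →L[ℝ] H) : Op.out G H (Op.mk G H A) = A := rfl

lemma Op.norm_out (A : Op G H) : ‖Op.out G H A‖ = ‖A‖ := rfl

/-- Pointwise application of a continuous family of operators. -/
def ptApply (K : Type) [TopologicalSpace K] [CompactSpace K]
    (G : Type) [NormedAddCommGroup G] [NormedSpace ℝ G]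
    (H : Type) [NormedAddCommGroup H] [NormedSpace ℝ H] :
    C(K, Op G H) →L[ℝ] C(K, G) →L[ℝ] C(K, H) :=
  LinearMap.mkContinuous₂
    (LinearMap.mk₂ ℝ (fun (A : C(K, Op G H)) (h : C(K, G)) =>
      (⟨fun k => Op.out G H (A k) (h k), by fun_prop⟩ : C(K, H)))
      (by intros; ext; simp) (by intros; ext; simp) (by intros; ext; simp) (by intros; ext; simp))
    1 (by
      intro A h
      rw [ContinuousMap.norm_le _ (by positivity)]
      intro k
      simp only [LinearMap.mk₂_apply, ContinuousMap.coe_mk, one_mul]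
      exact ((Op.out G H (A k)).le_opNorm _).trans (mul_le_mul (A.norm_coe_le_norm k) (h.norm_coe_le_norm k)
        (norm_nonneg _) (norm_nonneg _)))

@[simp] lemma ptApply_apply (A : C(K, Op G H)) (h : C(K, G)) (k : K) :
    ptApply K G H A h k = Op.out G H (A k) (h k) := rfl

lemma norm_ptApply_le : ‖ptApply K G H‖ ≤ 1 :=
  LinearMap.mkContinuous₂_norm_le _ zero_le_one _

lemma nem_hasFDerivAt (f : C(G, H)) (f' : C(G, Op G H)) (hf : ∀ x, HasFDerivAt f (Op.out G H (f' x)) x)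
    (γ : C(K, G)) :
    HasFDerivAt (fun γ : C(K, G) => f.comp γ) (ptApply K G H (f'.comp γ)) γ := by
  rw [hasFDerivAt_iff_isLittleO_nhds_zero, Asymptotics.isLittleO_iff]
  intro ε hε
  have hc : Continuous (fun γ : C(K, G) => f'.comp γ) := ContinuousMap.continuous_postcomp f'
  obtain ⟨δ, hδ, hδ'⟩ := Metric.continuousAt_iff.1 (hc.continuousAt (x := γ)) ε hε
  filter_upwards [Metric.ball_mem_nhds (0 : C(K, G)) hδ] with h hh
  rw [ContinuousMap.norm_le _ (by positivity)]
  intro k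
  have hh' : ‖h‖ < δ := by simpa using hh
  have key : ∀ z ∈ segment ℝ (γ k) (γ k + h k), ‖Op.out G H (f' z) - Op.out G H (f' (γ k))‖ ≤ ε := by
    intro z hz
    rw [segment_eq_image'] at hz
    obtain ⟨s, hs, rfl⟩ := hz
    have h1 := hδ' (x := γ + s • h) (by
      rw [dist_eq_norm]
      simp only [add_sub_cancel_left, norm_smul, Real.norm_eq_abs, abs_of_nonneg hs.1]
      nlinarith [hs.1, hs.2, norm_nonneg h])
    have h2 := (ContinuousMap.dist_apply_le_dist (f := f'.comp (γ + s • h)) (g := f'.comp γ) k)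
    rw [dist_eq_norm] at h2
    simp only [ContinuousMap.comp_apply, ContinuousMap.add_apply, ContinuousMap.smul_apply] at h2
    simp only [add_sub_cancel_left]
    exact h2.trans h1.le
  have := (convex_segment (𝕜 := ℝ) (γ k) (γ k + h k)).norm_image_sub_le_of_norm_hasFDerivWithin_le'
    (f := f) (f' := fun z => Op.out G H (f' z)) (φ := Op.out G H (f' (γ k))) (C := ε)
    (fun z _ => (hf z).hasFDerivWithinAt) key (left_mem_segment ℝ _ _) (right_mem_segment ℝ _ _)
  simp only [add_sub_cancel_left] at this
  simp only [ContinuousMap.sub_apply, ContinuousMap.comp_apply, ContinuousMap.add_apply,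
    ptApply_apply]
  exact this.trans (by gcongr; exact h.norm_coe_le_norm k)

lemma nem_contDiff_nat (m : ℕ) : ∀ {H : Type} [NormedAddCommGroup H] [NormedSpace ℝ H]
    (f : C(G, H)) (_ : ContDiff ℝ (⊤ : ℕ∞) f),
    ContDiff ℝ m (fun γ : C(K, G) => f.comp γ) := by
  induction m with
  | zero =>
    intro H _ _ f hf
    exact contDiff_zero.2 (ContinuousMap.continuous_postcomp f)
  | succ m ih =>
    intro H _ _ f hf
    have hd : Differentiable ℝ f := hf.differentiable (by simp)
    have hd' : ContDiff ℝ (⊤ : ℕ∞) (fderiv ℝ f) := hf.fderiv_right (by simp)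
    let f' : C(G, Op G H) := ⟨fun x => Op.mk G H (fderiv ℝ f x), (Op.mk G H).continuous.comp hd'.continuous⟩
    rw [show ((m + 1 : ℕ) : WithTop ℕ∞) = (m : WithTop ℕ∞) + 1 by simp, contDiff_succ_iff_hasFDerivAt]
    refine ⟨fun γ => ptApply K G H (f'.comp γ), ?_,
      fun γ => nem_hasFDerivAt f f' (fun x => (hd x).hasFDerivAt) γ⟩
    exact (ptApply K G H).contDiff.comp (ih f' ((Op.mk G H).contDiff.comp hd'))

lemma nem_contDiff (f : C(G, H)) (hf : ContDiff ℝ (⊤ : ℕ∞) f) :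
    ContDiff ℝ (⊤ : ℕ∞) (fun γ : C(K, G) => f.comp γ) :=
  contDiff_infty.2 fun m => nem_contDiff_nat m f hf

lemma ptApply_bound {K : Type} [TopologicalSpace K] [CompactSpace K]
   {G : Type} [NormedAddCommGroup G] [NormedSpace ℝ G]
   {H : Type} [NormedAddCommGroup H] [NormedSpace ℝ H] {Z : Type} [NormedAddCommGroup Z] [NormedSpace ℝ Z]
    (u : Z → C(K, Op G H)) (hu : ContDiff ℝ (⊤ : ℕ∞) u) (j : ℕ) (z : Z) {C : ℝ}
    (h : ‖iteratedFDeriv ℝ j u z‖ ≤ C) : ‖iteratedFDeriv ℝ j (fun z => ptApply K G H (u z)) z‖ ≤ C := by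
  have h1 := (ptApply K G H).norm_iteratedFDeriv_comp_left (hu.contDiffAt (x := z)) (n := j)
    (by exact_mod_cast le_top)
  have h2 := (norm_ptApply_le (K := K) (G := G) (H := H))
  have h3 := (mul_le_of_le_one_left (norm_nonneg (iteratedFDeriv ℝ j u z)) h2).trans h
  exact h1.trans h3

end Nemytskii


/-! ### Families of smooth maps with bounded derivatives of order at least one -/

section Bounded

variable {X Y Z : Type} [NormedAddCommGroup X] [NormedSpace ℝ X]
  [NormedAddCommGroup Y] [NormedSpace ℝ Y] [NormedAddCommGroup Z] [NormedSpace ℝ Z]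

/-- A family of smooth maps all of whose derivatives of order `≥ 1` are uniformly bounded. -/
structure BD {ι : Type} (f : ι → X → Y) : Prop where
  smooth : ∀ i, ContDiff ℝ (⊤ : ℕ∞) (f i)
  bdd : ∀ k : ℕ, 1 ≤ k → ∃ C : ℝ, ∀ i x, ‖iteratedFDeriv ℝ k (f i) x‖ ≤ C

lemma exists_bound_upto {ι : Type} {f : ι → X → Y}
    (h : ∀ k : ℕ, 1 ≤ k → ∃ C : ℝ, ∀ i x, ‖iteratedFDeriv ℝ k (f i) x‖ ≤ C) (n : ℕ) :
    ∃ C : ℝ, 1 ≤ C ∧ ∀ k, 1 ≤ k → k ≤ n → ∀ i x, ‖iteratedFDeriv ℝ k (f i) x‖ ≤ C := by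
  induction n with
  | zero => exact ⟨1, le_rfl, fun k h1 h2 => by omega⟩
  | succ n ih =>
    obtain ⟨C, hC1, hC⟩ := ih
    obtain ⟨D, hD⟩ := h (n + 1) (by omega)
    refine ⟨max C D, hC1.trans (le_max_left _ _), fun k h1 h2 i x => ?_⟩
    rcases Nat.lt_or_ge n k with h3 | h3
    · obtain rfl : k = n + 1 := by omega
      exact (hD i x).trans (le_max_right _ _)
    · exact (hC k h1 h3 i x).trans (le_max_left _ _)

lemma comp_bound {g : Y → Z} {f : X → Y} (hg : ContDiff ℝ (⊤ : ℕ∞) g)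
    (hf : ContDiff ℝ (⊤ : ℕ∞) f) {n : ℕ} (hn : 1 ≤ n) (x : X) {C D : ℝ} (hC0 : 0 ≤ C) (hD1 : 1 ≤ D)
    (hC : ∀ i, 1 ≤ i → i ≤ n → ‖iteratedFDeriv ℝ i g (f x)‖ ≤ C)
    (hD : ∀ i, 1 ≤ i → i ≤ n → ‖iteratedFDeriv ℝ i f x‖ ≤ D) :
    ‖iteratedFDeriv ℝ n (fun y => g (f y)) x‖ ≤ n.factorial * C * D ^ n := by
  have shift : ∀ {X' : Type} [NormedAddCommGroup X'] [NormedSpace ℝ X'] (u : X' → Z)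
      (_ : ContDiff ℝ (⊤ : ℕ∞) u) (c : Z) (i : ℕ) (_ : 1 ≤ i) (y : X'),
      iteratedFDeriv ℝ i (fun z => u z - c) y = iteratedFDeriv ℝ i u y := by
    intro X' _ _ u hu c i hi y
    rw [fun_iteratedFDeriv_sub_apply (hu.contDiffAt.of_le (by exact_mod_cast le_top))
      contDiff_const.contDiffAt, iteratedFDeriv_const_of_ne (by omega)]
    simp
  have h := norm_iteratedFDeriv_comp_le (g := fun z => g z - g (f x)) (f := f) (n := n)
    (N := (⊤ : ℕ∞)) (hg.sub contDiff_const) hf (by exact_mod_cast le_top) x (C := C) (D := D)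
    (by
      intro i hi
      rcases Nat.eq_zero_or_pos i with rfl | h0
      · simpa using hC0
      · rw [shift g hg _ i h0]
        exact hC i h0 hi)
    (by
      intro i h1 hi
      exact (hD i h1 hi).trans (le_self_pow₀ hD1 (by omega)))
  have e := shift (fun y => g (f y)) (hg.comp hf) (g (f x)) n hn x
  rw [← e]
  exact h

lemma BD.comp {ι : Type} {g : ι → Y → Z} {f : ι → X → Y} (hg : BD g) (hf : BD f) :
    BD (fun i x => g i (f i x)) := by
  refine ⟨fun i => (hg.smooth i).comp (hf.smooth i), fun k hk => ?_⟩
  obtain ⟨C, hC1, hC⟩ := exists_bound_upto hg.bdd k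
  obtain ⟨D, hD1, hD⟩ := exists_bound_upto hf.bdd k
  exact ⟨_, fun i x => comp_bound (hg.smooth i) (hf.smooth i) hk x (by linarith) hD1
    (fun j h1 h2 => hC j h1 h2 i _) (fun j h1 h2 => hD j h1 h2 i _)⟩

lemma BD.clm {ι : Type} (L : X →L[ℝ] Y) : BD (fun (_ : ι) x => L x) := by
  refine ⟨fun _ => L.contDiff, fun k hk => ⟨‖L‖, fun i x => ?_⟩⟩
  obtain ⟨k, rfl⟩ : ∃ m, k = m + 1 := ⟨k - 1, by omega⟩
  rw [← norm_iteratedFDeriv_fderiv]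
  have : fderiv ℝ (fun x => L x) = fun _ => L := by ext1 y; exact L.fderiv
  rw [this]
  rcases Nat.eq_zero_or_pos k with rfl | h0
  · simp
  · rw [iteratedFDeriv_const_of_ne (by omega)]; simp

lemma BD.sub {ι : Type} {f g : ι → X → Y} (hf : BD f) (hg : BD g) :
    BD (fun i x => f i x - g i x) := by
  refine ⟨fun i => (hf.smooth i).sub (hg.smooth i), fun k hk => ?_⟩
  obtain ⟨C, hC⟩ := hf.bdd k hk
  obtain ⟨D, hD⟩ := hg.bdd k hk
  refine ⟨C + D, fun i x => ?_⟩
  rw [fun_iteratedFDeriv_sub_apply ((hf.smooth i).contDiffAt.of_le (by exact_mod_cast le_top))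
    ((hg.smooth i).contDiffAt.of_le (by exact_mod_cast le_top))]
  exact (norm_sub_le _ _).trans (add_le_add (hC i x) (hD i x))

lemma BD.smul {ι : Type} {f : ι → X → Y} (hf : BD f) (c : ι → ℝ) (hc : ∀ i, |c i| ≤ 1) :
    BD (fun i x => c i • f i x) := by
  refine ⟨fun i => (hf.smooth i).const_smul _, fun k hk => ?_⟩
  obtain ⟨C, hC⟩ := hf.bdd k hk
  refine ⟨C, fun i x => ?_⟩
  rw [iteratedFDeriv_const_smul_apply' ((hf.smooth i).contDiffAt.of_le (by exact_mod_cast le_top)),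
    norm_smul]
  have := hC i x
  have h2 := hc i
  rw [Real.norm_eq_abs]
  nlinarith [norm_nonneg (iteratedFDeriv ℝ k (f i) x), abs_nonneg (c i)]

lemma BD.reindex {ι κ : Type} {f : ι → X → Y} (hf : BD f) (e : κ → ι) :
    BD (fun i x => f (e i) x) :=
  ⟨fun i => hf.smooth _, fun k hk => (hf.bdd k hk).imp fun _ h i x => h _ x⟩

end Bounded

/-! ### A uniform global inverse function theorem -/

section Inverse

variable {W : Type} [NormedAddCommGroup W] [NormedSpace ℝ W]

lemma inverse_bounds {ι : Type} (t : ι → ℝ) (S g : ι → W → W) (hS : BD S)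
    (hg : ∀ i, ContDiff ℝ (⊤ : ℕ∞) (g i))
    (hhalf : ∀ i x, |t i| * ‖fderiv ℝ (S i) x‖ ≤ 1 / 2) (ht1 : ∀ i, |t i| ≤ 1)
    (heq : ∀ i x, g i x + t i • S i (g i x) = x) : BD g := by
  have hd : ∀ i, fderiv ℝ (g i) = fun x => ContinuousLinearMap.id ℝ W -
      t i • (ContinuousLinearMap.compL ℝ W W W (fderiv ℝ (S i) (g i x)) (fderiv ℝ (g i) x)) := by
    intro i
    funext x
    have h1 : HasFDerivAt (g i) (fderiv ℝ (g i) x) x :=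
      ((hg i).differentiable (by simp) x).hasFDerivAt
    have h2 : HasFDerivAt (S i) (fderiv ℝ (S i) (g i x)) (g i x) :=
      ((hS.smooth i).differentiable (by simp) _).hasFDerivAt
    have h3 := h1.add ((h2.comp x h1).const_smul (t i))
    have h4 : HasFDerivAt (fun x : W => x) (ContinuousLinearMap.id ℝ W) x := hasFDerivAt_id x
    have h5 := h3.unique (h4.congr_of_eventuallyEq (Filter.Eventually.of_forall fun y => heq i y))
    rw [← h5]
    simp
  have hSd : ∀ k : ℕ, 1 ≤ k → ∃ C : ℝ, ∀ i x, ‖iteratedFDeriv ℝ k (fderiv ℝ (S i)) x‖ ≤ C := by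
    intro k hk
    obtain ⟨C, hC⟩ := hS.bdd (k + 1) (by omega)
    exact ⟨C, fun i x => by rw [norm_iteratedFDeriv_fderiv]; exact hC i x⟩
  have hSs : ∀ i, ContDiff ℝ (⊤ : ℕ∞) (fderiv ℝ (S i)) := fun i =>
    (hS.smooth i).fderiv_right (by simp)
  have hgs : ∀ i, ContDiff ℝ (⊤ : ℕ∞) (fderiv ℝ (g i)) := fun i =>
    (hg i).fderiv_right (by simp)
  have main : ∀ n : ℕ, ∃ C : ℝ, 1 ≤ C ∧ ∀ m < n, ∀ i x,
      ‖iteratedFDeriv ℝ m (fderiv ℝ (g i)) x‖ ≤ C := by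
    intro n
    induction n with
    | zero => exact ⟨1, le_rfl, fun m hm => by omega⟩
    | succ n ih =>
      obtain ⟨B, hB1, hB⟩ := ih
      obtain ⟨C, hC1, hC⟩ := exists_bound_upto hSd n
      let A : ℝ := ∑ j ∈ Finset.range n, (n.choose (j + 1) : ℝ) *
        ((j + 1).factorial * C * B ^ (j + 1)) * B
      have hA : ∀ i x, ‖iteratedFDeriv ℝ n (fderiv ℝ (g i)) x‖ ≤ 2 * (1 + A) := by
        intro i x
        have hcs : ContDiff ℝ (⊤ : ℕ∞) (fun x => fderiv ℝ (S i) (g i x)) := (hSs i).comp (hg i)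
        have h1 := (ContinuousLinearMap.compL ℝ W W W).norm_iteratedFDeriv_le_of_bilinear_of_le_one
          hcs (hgs i) x (n := n) (by exact_mod_cast le_top)
          (ContinuousLinearMap.norm_compL_le ℝ W W W)
        rw [Finset.sum_range_succ'] at h1
        have h2 : ∑ j ∈ Finset.range n, (n.choose (j + 1) : ℝ) *
            ‖iteratedFDeriv ℝ (j + 1) (fun x => fderiv ℝ (S i) (g i x)) x‖ *
            ‖iteratedFDeriv ℝ (n - (j + 1)) (fderiv ℝ (g i)) x‖ ≤ A := by
          refine Finset.sum_le_sum fun j hj => ?_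
          have hj' : j < n := Finset.mem_range.1 hj
          have h3 := comp_bound (hSs i) (hg i) (n := j + 1) (by omega) x (C := C) (D := B)
            (by linarith) hB1 (fun k h1 h2 => hC k h1 (by omega) i _) (fun k h1 h2 => by
              obtain ⟨k, rfl⟩ : ∃ m, k = m + 1 := ⟨k - 1, by omega⟩
              rw [← norm_iteratedFDeriv_fderiv]
              exact hB k (by omega) i x)
          have h4 := hB (n - (j + 1)) (by omega) i x
          gcongr
        have h5 : ‖iteratedFDeriv ℝ n (fun _ : W => ContinuousLinearMap.id ℝ W) x‖ ≤ 1 := by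
          rcases Nat.eq_zero_or_pos n with rfl | h0
          · simpa using ContinuousLinearMap.norm_id_le
          · rw [iteratedFDeriv_const_of_ne (by omega)]; simp
        have hbs : ContDiff ℝ (⊤ : ℕ∞) (fun x => ContinuousLinearMap.compL ℝ W W W
            (fderiv ℝ (S i) (g i x)) (fderiv ℝ (g i) x)) :=
          ContDiff.clm_apply ((ContinuousLinearMap.compL ℝ W W W).contDiff.comp hcs) (hgs i)
        have h6 : iteratedFDeriv ℝ n (fderiv ℝ (g i)) x =
            iteratedFDeriv ℝ n (fun _ : W => ContinuousLinearMap.id ℝ W) x -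
            t i • iteratedFDeriv ℝ n (fun x => ContinuousLinearMap.compL ℝ W W W
              (fderiv ℝ (S i) (g i x)) (fderiv ℝ (g i) x)) x := by
          conv_lhs => rw [hd i]
          rw [fun_iteratedFDeriv_sub_apply contDiff_const.contDiffAt
            ((hbs.const_smul _).contDiffAt.of_le (by exact_mod_cast le_top)),
            iteratedFDeriv_const_smul_apply' (hbs.contDiffAt.of_le (by exact_mod_cast le_top))]
        have h7 := norm_sub_le (iteratedFDeriv ℝ n (fun _ : W => ContinuousLinearMap.id ℝ W) x)
          (t i • iteratedFDeriv ℝ n (fun x => ContinuousLinearMap.compL ℝ W W W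
              (fderiv ℝ (S i) (g i x)) (fderiv ℝ (g i) x)) x)
        rw [← h6, norm_smul, Real.norm_eq_abs] at h7
        simp only [Nat.choose_zero_right, Nat.cast_one, one_mul, norm_iteratedFDeriv_zero,
          Nat.sub_zero] at h1
        have h8 := mul_le_mul_of_nonneg_left (h1.trans (add_le_add_left h2 _)) (abs_nonneg (t i))
        have h9 := mul_le_mul_of_nonneg_right (hhalf i (g i x))
          (norm_nonneg (iteratedFDeriv ℝ n (fderiv ℝ (g i)) x))
        have hA0 : 0 ≤ A := by
          apply Finset.sum_nonneg; intros; positivity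
        have h10 := mul_le_mul_of_nonneg_right (ht1 i) hA0
        nlinarith
      refine ⟨max B (2 * (1 + A)), hB1.trans (le_max_left _ _), fun m hm i x => ?_⟩
      rcases Nat.lt_or_ge m n with h3 | h3
      · exact (hB m h3 i x).trans (le_max_left _ _)
      · obtain rfl : m = n := by omega
        exact (hA i x).trans (le_max_right _ _)
  refine ⟨hg, fun k hk => ?_⟩
  obtain ⟨C, _, hC⟩ := main k
  obtain ⟨k, rfl⟩ : ∃ m, k = m + 1 := ⟨k - 1, by omega⟩
  exact ⟨C, fun i x => by rw [← norm_iteratedFDeriv_fderiv]; exact hC k (by omega) i x⟩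

end Inverse


section Inverse2

variable {W : Type} [NormedAddCommGroup W] [NormedSpace ℝ W] [CompleteSpace W]

lemma inverse_unique {t : ℝ} {S : W → W} (hS : ContDiff ℝ (⊤ : ℕ∞) S)
    (hhalf : ∀ x, |t| * ‖fderiv ℝ S x‖ ≤ 1 / 2) (x y : W) :
    ‖t • S x - t • S y‖ ≤ 1 / 2 * ‖x - y‖ := by
  have h := Convex.norm_image_sub_le_of_norm_fderiv_le (𝕜 := ℝ) (f := fun z => t • S z)
    (s := Set.univ) (C := 1 / 2)
    (fun z _ => ((hS.differentiable (by simp)) z).const_smul t) (fun z _ => by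
      rw [fderiv_fun_const_smul ((hS.differentiable (by simp)) z), norm_smul, Real.norm_eq_abs]
      exact hhalf z) convex_univ (Set.mem_univ y) (Set.mem_univ x)
  exact h

lemma inverse_exists {t : ℝ} {S : W → W} (hS : ContDiff ℝ (⊤ : ℕ∞) S)
    (hhalf : ∀ x, |t| * ‖fderiv ℝ S x‖ ≤ 1 / 2) (η : W) :
    ∃ x, x + t • S x = η := by
  have hc : ContractingWith (1 / 2) (fun x => η - t • S x) := by
    refine ⟨by
      have : ((1 / 2 : NNReal) : ℝ) < 1 := by norm_num
      exact_mod_cast this, LipschitzWith.of_dist_le_mul fun x y => ?_⟩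
    rw [dist_eq_norm, dist_eq_norm]
    have := inverse_unique hS hhalf y x
    rw [norm_sub_rev y x] at this
    simpa using this
  refine ⟨hc.fixedPoint, ?_⟩
  have h : η - t • S hc.fixedPoint = hc.fixedPoint := hc.fixedPoint_isFixedPt
  exact (sub_eq_iff_eq_add.1 h).symm

lemma global_inverse (S : ℝ → W → W)
    (hS : ContDiff ℝ (⊤ : ℕ∞) (fun p : ℝ × W => S p.1 p.2))
    (hB : BD (fun t : {t : ℝ // |t| ≤ 1} => S t)) :
    ∃ T0 > (0 : ℝ), T0 ≤ 1 ∧ ∃ g : ℝ → W → W,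
      ContDiffOn ℝ (⊤ : ℕ∞) (fun p : ℝ × W => g p.1 p.2) (Ioo (-T0) T0 ×ˢ univ) ∧
      (∀ t ∈ Ioo (-T0) T0, ∀ η, g t η + t • S t (g t η) = η) ∧
      BD (fun t : Ioo (-T0) T0 => g t) := by
  obtain ⟨C, hC1, hC⟩ := exists_bound_upto hB.bdd 1
  let T0 : ℝ := 1 / (2 * C)
  have hT0 : 0 < T0 := by positivity
  have hT1 : T0 ≤ 1 := by
    rw [div_le_one (by positivity)]; linarith
  have hTC : T0 * C = 1 / 2 := by
    simp only [T0]; field_simp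
  have habs : ∀ t ∈ Ioo (-T0) T0, |t| < T0 := fun t ht => abs_lt.2 ht
  have hSt : ∀ t, ContDiff ℝ (⊤ : ℕ∞) (S t) := fun t =>
    hS.comp (contDiff_const.prodMk contDiff_id)
  have hhalf : ∀ t ∈ Ioo (-T0) T0, ∀ x, |t| * ‖fderiv ℝ (S t) x‖ ≤ 1 / 2 := by
    intro t ht x
    have h1 := hC 1 le_rfl le_rfl ⟨t, (habs t ht).le.trans hT1⟩ x
    rw [norm_iteratedFDeriv_one] at h1
    rw [← hTC]
    exact mul_le_mul (habs t ht).le h1 (norm_nonneg _) hT0.le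
  have hex : ∀ t η, ∃ x, t ∈ Ioo (-T0) T0 → x + t • S t x = η := by
    intro t η
    by_cases ht : t ∈ Ioo (-T0) T0
    · obtain ⟨x, hx⟩ := inverse_exists (hSt t) (hhalf t ht) η
      exact ⟨x, fun _ => hx⟩
    · exact ⟨0, fun h => absurd h ht⟩
  choose g hg using hex
  have huniq : ∀ t ∈ Ioo (-T0) T0, ∀ η x, x + t • S t x = η → x = g t η := by
    intro t ht η x hx
    have h1 := hg t η ht
    have h2 := inverse_unique (hSt t) (hhalf t ht) (g t η) x
    have h3 : t • S t (g t η) - t • S t x = x - g t η := by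
      rw [sub_eq_sub_iff_add_eq_add, add_comm, h1, hx]
    rw [h3, norm_sub_rev] at h2
    have h4 : ‖g t η - x‖ = 0 := by linarith [norm_nonneg (g t η - x)]
    exact (sub_eq_zero.1 (norm_eq_zero.1 h4)).symm
  have hsm : ∀ t ∈ Ioo (-T0) T0, ∀ η, ContDiffAt ℝ (⊤ : ℕ∞) (fun p : ℝ × W => g p.1 p.2) (t, η) := by
    intro t ht η
    let P : ℝ × W → W := fun p => p.2 + p.1 • S p.1 p.2
    have hP : ContDiff ℝ (⊤ : ℕ∞) P := contDiff_snd.add (contDiff_fst.smul hS)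
    let a : ℝ × W := (t, g t η)
    have hP' : HasFDerivAt P (fderiv ℝ P a) a := (hP.differentiable (by simp) a).hasFDerivAt
    let A : W →L[ℝ] W := -(t • fderiv ℝ (S t) (g t η))
    have hA : ‖A‖ < 1 := by
      have := hhalf t ht (g t η)
      simp only [A, norm_neg, norm_smul, Real.norm_eq_abs]
      linarith
    let e : W ≃L[ℝ] W := ContinuousLinearEquiv.ofUnit (Units.oneSub A hA)
    have he : ∀ h, fderiv ℝ P a (0, h) = e h := by
      intro h
      have h1 : HasFDerivAt (fun y : W => (t, y)) (ContinuousLinearMap.inr ℝ ℝ W) (g t η) :=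
        hasFDerivAt_prodMk_right t (g t η)
      have h2 := hP'.comp (g t η) h1
      have h3 : HasFDerivAt (fun y : W => y + t • S t y)
        (ContinuousLinearMap.id ℝ W + t • fderiv ℝ (S t) (g t η)) (g t η) :=
        (hasFDerivAt_id _).add
          ((((hSt t).differentiable (by simp)) _).hasFDerivAt.const_smul t)
      have h4 := h2.unique h3
      have h5 := congrArg (fun L : W →L[ℝ] W => L h) h4
      simp only [ContinuousLinearMap.comp_apply, ContinuousLinearMap.inr_apply] at h5
      rw [h5]
      change _ = ((1 : W →L[ℝ] W) - A) h
      simp [A]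
    let f' : (ℝ × W) ≃L[ℝ] ℝ × W := (ContinuousLinearEquiv.refl ℝ ℝ).skewProd e
      ((fderiv ℝ P a).comp (ContinuousLinearMap.inl ℝ ℝ W))
    have hΨ : ContDiff ℝ (⊤ : ℕ∞) (fun p : ℝ × W => (p.1, P p)) := contDiff_fst.prodMk hP
    have hΨ' : HasFDerivAt (fun p : ℝ × W => (p.1, P p)) (f' : ℝ × W →L[ℝ] ℝ × W) a := by
      have h1 := (hasFDerivAt_fst (𝕜 := ℝ) (p := a)).prodMk hP'
      refine h1.congr_fderiv ?_
      refine ContinuousLinearMap.ext fun q => ?_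
      obtain ⟨τ, h⟩ := q
      have h6 : fderiv ℝ P a (τ, h) = e h + fderiv ℝ P a (τ, 0) := by
        rw [← he, ← map_add]; simp
      simp [f', h6]
    have hne : ((⊤ : ℕ∞) : WithTop ℕ∞) ≠ 0 := by simp
    let loc := hΨ.contDiffAt.toOpenPartialHomeomorph (fun p : ℝ × W => (p.1, P p)) hΨ' hne
    have hloc : ContDiffAt ℝ (⊤ : ℕ∞) (loc.symm) (t, η) := by
      have := hΨ.contDiffAt.to_localInverse hΨ' hne
      have h2 : ((a.1, P a) : ℝ × W) = (t, η) := by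
        simp only [a, P, hg t η ht]
      rw [← h2]
      exact this
    have hmem : (t, η) ∈ loc.target := by
      have := hΨ.contDiffAt.image_mem_toOpenPartialHomeomorph_target hΨ' hne
      have h2 : ((a.1, P a) : ℝ × W) = (t, η) := by
        simp only [a, P, hg t η ht]
      rw [← h2]
      exact this
    refine (contDiffAt_snd.comp (t, η) hloc).congr_of_eventuallyEq ?_
    have hT : ∀ᶠ q : ℝ × W in nhds (t, η), q.1 ∈ Ioo (-T0) T0 :=
      continuous_fst.continuousAt.eventually_mem (isOpen_Ioo.mem_nhds ht)
    filter_upwards [loc.open_target.mem_nhds hmem, hT] with q hq hqT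
    have h7 : loc (loc.symm q) = q := loc.right_inv hq
    have h8 : (fun p : ℝ × W => (p.1, P p)) (loc.symm q) = q := h7
    have h9 : (loc.symm q).1 = q.1 := by
      have := congrArg Prod.fst h8
      exact this
    have h10 : P (loc.symm q) = q.2 := by
      have := congrArg Prod.snd h8
      exact this
    simp only [P, h9] at h10
    exact (huniq q.1 hqT q.2 _ h10).symm
  refine ⟨T0, hT0, hT1, g, ?_, fun t ht η => hg t η ht, ?_⟩
  · rintro ⟨t, η⟩ ⟨ht, -⟩
    exact (hsm t ht η).contDiffWithinAt
  · have hSB : BD (fun t : Ioo (-T0) T0 => S t) :=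
      hB.reindex (fun t : Ioo (-T0) T0 => (⟨t, (habs t t.2).le.trans hT1⟩ : {t : ℝ // |t| ≤ 1}))
    refine inverse_bounds (fun t : Ioo (-T0) T0 => (t : ℝ)) (fun t => S t) (fun t => g t) hSB
      (fun t => ?_) (fun t x => hhalf t t.2 x) (fun t => (habs t t.2).le.trans hT1)
      (fun t x => hg t x t.2)
    rw [contDiff_iff_contDiffAt]
    intro x
    exact (hsm t t.2 x).comp (f := fun y : W => ((t : ℝ), y)) x
      (contDiff_const.prodMk contDiff_id).contDiffAt

end Inverse2


/-! ### Curves on the unit interval -/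

section Curves

variable {E : Type} [NormedAddCommGroup E] [NormedSpace ℝ E]
variable {F : Type} [NormedAddCommGroup F] [NormedSpace ℝ F]

/-- `(t, γ) ↦ (θ ↦ (t θ, γ θ))`. -/
def graphI (E : Type) [NormedAddCommGroup E] [NormedSpace ℝ E] :
    ℝ × C(unitInterval, E) →L[ℝ] C(unitInterval, ℝ × E) :=
  LinearMap.mkContinuous
    { toFun := fun p => ⟨fun θ => (p.1 * θ, p.2 θ), by fun_prop⟩
      map_add' := by intro p q; ext θ <;> simp [add_mul]
      map_smul' := by intro c p; ext θ <;> simp [mul_assoc] }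
    1 (by
      intro p
      rw [ContinuousMap.norm_le _ (by positivity)]
      intro θ
      simp only [LinearMap.coe_mk, AddHom.coe_mk, ContinuousMap.coe_mk, one_mul]
      rw [Prod.norm_def]
      refine max_le ?_ ?_
      · refine le_trans ?_ (norm_fst_le p)
        simp only [norm_mul]
        refine mul_le_of_le_one_right (norm_nonneg _) ?_
        rw [Real.norm_eq_abs, abs_of_nonneg θ.2.1]
        exact θ.2.2
      · exact (p.2.norm_coe_le_norm θ).trans (norm_snd_le p))

@[simp] lemma graphI_apply (p : ℝ × C(unitInterval, E)) (θ : unitInterval) :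
    graphI E p θ = (p.1 * θ, p.2 θ) := rfl

/-- Constant curves. -/
def constI (E : Type) [NormedAddCommGroup E] [NormedSpace ℝ E] :
    E →L[ℝ] C(unitInterval, E) :=
  LinearMap.mkContinuous
    { toFun := fun x => ContinuousMap.const _ x
      map_add' := by intro p q; ext θ; simp
      map_smul' := by intro c p; ext θ; simp }
    1 (by
      intro p
      rw [ContinuousMap.norm_le _ (by positivity)]
      intro θ
      simp)

@[simp] lemma constI_apply (x : E) (θ : unitInterval) : constI E x θ = x := rfl

/-- Evaluation. -/
def evI (E : Type) [NormedAddCommGroup E] [NormedSpace ℝ E] (θ : unitInterval) :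
    C(unitInterval, E) →L[ℝ] E :=
  LinearMap.mkContinuous
    { toFun := fun x => x θ
      map_add' := by intro p q; simp
      map_smul' := by intro c p; simp }
    1 (by
      intro p
      simpa using p.norm_coe_le_norm θ)

@[simp] lemma evI_apply (w : C(unitInterval, E)) (θ : unitInterval) : evI E θ w = w θ := rfl

/-- Extension of a curve to the real line by constants. -/
def extI (w : C(unitInterval, F)) : ℝ → F := Set.IccExtend (zero_le_one' ℝ) w

lemma extI_continuous (w : C(unitInterval, F)) : Continuous (extI w) :=
  w.continuous.Icc_extend'

lemma extI_coe (w : C(unitInterval, F)) (θ : unitInterval) : extI w θ = w θ :=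
  Set.IccExtend_val _ _ θ

lemma extI_of_mem (w : C(unitInterval, F)) {s : ℝ} (hs : s ∈ Icc (0 : ℝ) 1) :
    extI w s = w ⟨s, hs⟩ :=
  Set.IccExtend_of_mem _ _ hs

lemma norm_extI_le (w : C(unitInterval, F)) (s : ℝ) : ‖extI w s‖ ≤ ‖w‖ :=
  w.norm_coe_le_norm _

lemma nem_slab_bound (j : ℕ) : ∀ {F : Type} [NormedAddCommGroup F] [NormedSpace ℝ F]
    (f : C(ℝ × E, F)) (_ : ContDiff ℝ (⊤ : ℕ∞) f) (C : ℝ)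
    (_ : ∀ s : ℝ, |s| ≤ 1 → ∀ x, ‖iteratedFDeriv ℝ j (fun y => f (s, y)) x‖ ≤ C) (t : ℝ)
    (_ : |t| ≤ 1) (γ : C(unitInterval, E)),
    ‖iteratedFDeriv ℝ j (fun γ => f.comp (graphI E (t, γ))) γ‖ ≤ C := by
  induction j with
  | zero =>
    intro F _ _ f hf C hC t ht γ
    have hC0 : 0 ≤ C := (norm_nonneg _).trans (hC 0 (by simp) 0)
    rw [norm_iteratedFDeriv_zero, ContinuousMap.norm_le _ hC0]
    intro θ
    have := hC (t * θ) (by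
      rw [abs_mul, abs_of_nonneg θ.2.1]
      exact mul_le_one₀ ht θ.2.1 θ.2.2) (γ θ)
    rw [norm_iteratedFDeriv_zero] at this
    exact this
  | succ j ih =>
    intro F _ _ f hf C hC t ht γ
    have hd : Differentiable ℝ f := hf.differentiable (by simp)
    have hd' : ContDiff ℝ (⊤ : ℕ∞) (fderiv ℝ f) := hf.fderiv_right (by simp)
    let f' : C(ℝ × E, Op (ℝ × E) F) :=
      ⟨fun x => Op.mk (ℝ × E) F (fderiv ℝ f x), (Op.mk _ _).continuous.comp hd'.continuous⟩
    have hx : ContDiff ℝ (⊤ : ℕ∞) (fun p => Op.mk E F ((fderiv ℝ f p).comp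
        (ContinuousLinearMap.inr ℝ ℝ E))) :=
      (Op.mk E F).contDiff.comp (hd'.clm_comp contDiff_const)
    let fx : C(ℝ × E, Op E F) := ⟨_, hx.continuous⟩
    have hslice : ∀ s x, fderiv ℝ (fun y => f (s, y)) x =
        (fderiv ℝ f (s, x)).comp (ContinuousLinearMap.inr ℝ ℝ E) := by
      intro s x
      exact ((hd (s, x)).hasFDerivAt.comp x (hasFDerivAt_prodMk_right s x)).fderiv
    have hfd : fderiv ℝ (fun γ => f.comp (graphI E (t, γ))) =
        fun γ => ptApply unitInterval E F (fx.comp (graphI E (t, γ))) := by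
      funext γ
      have h1 := nem_hasFDerivAt f f' (fun x => (hd x).hasFDerivAt) (graphI E (t, γ))
      have h2 := h1.comp γ ((graphI E).hasFDerivAt.comp γ (hasFDerivAt_prodMk_right t γ))
      refine h2.fderiv.trans ?_
      refine ContinuousLinearMap.ext fun h => ContinuousMap.ext fun θ => ?_
      change fderiv ℝ f (t * θ, γ θ) ((0 : ℝ) * θ, h θ) = fderiv ℝ f (t * θ, γ θ) (0, h θ)
      rw [zero_mul]
    rw [← norm_iteratedFDeriv_fderiv, hfd]
    have hsm : ContDiff ℝ (⊤ : ℕ∞) (fun γ => fx.comp (graphI E (t, γ))) :=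
      (nem_contDiff fx hx).comp ((graphI E).contDiff.comp (contDiff_const.prodMk contDiff_id))
    refine ptApply_bound _ hsm j γ ?_
    refine ih fx hx C (fun s hs x => ?_) t ht γ
    have h3 := hC s hs x
    rw [← norm_iteratedFDeriv_fderiv] at h3
    have h4 : (fun y => fx (s, y)) = Op.mk E F ∘ fderiv ℝ (fun y => f (s, y)) := by
      funext y
      simp only [Function.comp, hslice]
      rfl
    rw [h4]
    have h5 : ContDiff ℝ (⊤ : ℕ∞) (fun y => f (s, y)) :=
      hf.comp (contDiff_const.prodMk contDiff_id)
    refine ((Op.mk E F).norm_iteratedFDeriv_comp_left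
      ((h5.fderiv_right (m := (⊤ : ℕ∞)) (by simp)).contDiffAt (x := x)) (n := j)
      (by exact_mod_cast le_top)).trans ?_
    refine (mul_le_of_le_one_left (norm_nonneg _) ?_).trans h3
    exact ContinuousLinearMap.opNorm_le_bound _ zero_le_one fun A => by rw [one_mul]; rfl

variable [CompleteSpace F]

/-- Primitive of a curve vanishing at `0`. -/
def primI (F : Type) [NormedAddCommGroup F] [NormedSpace ℝ F] [CompleteSpace F] :
    C(unitInterval, F) →L[ℝ] C(unitInterval, F) :=
  LinearMap.mkContinuous
    { toFun := fun w => ⟨fun θ => ∫ s in (0 : ℝ)..θ, extI w s, by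
        have h : Continuous fun x : ℝ => ∫ s in (0 : ℝ)..x, extI w s :=
          intervalIntegral.continuous_primitive
            (fun a b => (extI_continuous w).intervalIntegrable a b) 0
        exact h.comp continuous_subtype_val⟩
      map_add' := by
        intro p q
        ext θ
        simp only [ContinuousMap.coe_mk, ContinuousMap.add_apply]
        rw [← intervalIntegral.integral_add ((extI_continuous p).intervalIntegrable _ _)
          ((extI_continuous q).intervalIntegrable _ _)]
        rfl
      map_smul' := by
        intro c p
        ext θ
        simp only [ContinuousMap.coe_mk, ContinuousMap.smul_apply, RingHom.id_apply]
        rw [← intervalIntegral.integral_smul]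
        rfl }
    1 (by
      intro p
      rw [ContinuousMap.norm_le _ (by positivity)]
      intro θ
      have h := intervalIntegral.norm_integral_le_of_norm_le_const (a := (0 : ℝ)) (b := θ)
        (f := extI p) (C := ‖p‖) (fun s _ => norm_extI_le p s)
      simp only [LinearMap.coe_mk, AddHom.coe_mk, ContinuousMap.coe_mk, one_mul]
      refine h.trans (mul_le_of_le_one_right (norm_nonneg _) ?_)
      rw [sub_zero, abs_of_nonneg θ.2.1]
      exact θ.2.2)

lemma primI_apply (w : C(unitInterval, F)) (θ : unitInterval) :
    primI F w θ = ∫ s in (0 : ℝ)..θ, extI w s := rfl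

@[simp] lemma primI_zero (w : C(unitInterval, F)) : primI F w 0 = 0 := by
  simp [primI_apply]

lemma primI_one (w : C(unitInterval, F)) : primI F w 1 = ∫ s in (0 : ℝ)..1, extI w s := rfl

lemma extI_primI (w : C(unitInterval, F)) {s : ℝ} (hs : s ∈ Icc (0 : ℝ) 1) :
    extI (primI F w) s = ∫ r in (0 : ℝ)..s, extI w r := by
  rw [extI_of_mem _ hs]; rfl

lemma hasDerivAt_primI (w : C(unitInterval, F)) {s : ℝ} (hs : s ∈ Ioo (0 : ℝ) 1) :
    HasDerivAt (extI (primI F w)) (extI w s) s := by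
  have h := intervalIntegral.integral_hasDerivAt_right
    ((extI_continuous w).intervalIntegrable 0 s)
    ((extI_continuous w).stronglyMeasurableAtFilter _ _) (extI_continuous w).continuousAt
  refine h.congr_of_eventuallyEq ?_
  filter_upwards [isOpen_Ioo.mem_nhds hs] with r hr
  exact extI_primI w ⟨hr.1.le, hr.2.le⟩

/-- Primitive of a curve vanishing at `1`, with a minus sign: `θ ↦ ∫_θ^1 w`. -/
def coprimI (F : Type) [NormedAddCommGroup F] [NormedSpace ℝ F] [CompleteSpace F] :
    C(unitInterval, F) →L[ℝ] C(unitInterval, F) :=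
  (constI F).comp ((evI F 1).comp (primI F)) - primI F

lemma coprimI_apply (w : C(unitInterval, F)) (θ : unitInterval) :
    coprimI F w θ = primI F w 1 - primI F w θ := rfl

end Curves



/-! ### Integration along curves -/

section Action

variable {E : Type} [NormedAddCommGroup E] [InnerProductSpace ℝ E] [CompleteSpace E]

/-- Integral of a curve. -/
def JI (F : Type) [NormedAddCommGroup F] [NormedSpace ℝ F] [CompleteSpace F] :
    C(unitInterval, F) →L[ℝ] F := (evI F 1).comp (primI F)

lemma JI_eq {F : Type} [NormedAddCommGroup F] [NormedSpace ℝ F] [CompleteSpace F]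
    (w : C(unitInterval, F)) : JI F w = ∫ s in (0 : ℝ)..1, extI w s := rfl

/-- Fundamental theorem of calculus for curves. -/
lemma ftcI {F : Type} [NormedAddCommGroup F] [NormedSpace ℝ F] [CompleteSpace F]
    (f f' : C(unitInterval, F))
    (h : ∀ s ∈ Ioo (0 : ℝ) 1, HasDerivAt (extI f) (extI f' s) s) :
    JI F f' = f 1 - f 0 := by
  rw [JI_eq, intervalIntegral.integral_eq_sub_of_hasDerivAt_of_le zero_le_one
    (extI_continuous f).continuousOn h ((extI_continuous f').intervalIntegrable _ _)]
  have h1 := extI_coe f 1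
  have h0 := extI_coe f 0
  simp only [Icc.coe_one, Icc.coe_zero] at h1 h0
  rw [h1, h0]

/-- Pointwise inner product of curves. -/
def inI (a b : C(unitInterval, E)) : C(unitInterval, ℝ) :=
  ⟨fun θ => inner ℝ (a θ) (b θ), by fun_prop⟩

@[simp] lemma inI_apply (a b : C(unitInterval, E)) (θ : unitInterval) :
    inI a b θ = inner ℝ (a θ) (b θ) := rfl

lemma extI_inI (a b : C(unitInterval, E)) (s : ℝ) :
    extI (inI a b) s = inner ℝ (extI a s) (extI b s) := rfl

lemma hasDerivAt_coprimI (w : C(unitInterval, E)) {s : ℝ} (hs : s ∈ Ioo (0 : ℝ) 1) :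
    HasDerivAt (extI (coprimI E w)) (-extI w s) s := by
  have h := (hasDerivAt_primI w hs).const_sub (primI E w 1)
  exact h

lemma coprimI_zero (w : C(unitInterval, E)) : coprimI E w 0 = JI E w := by
  rw [coprimI_apply, primI_zero, sub_zero]; rfl

lemma coprimI_one (w : C(unitInterval, E)) : coprimI E w 1 = 0 := by
  rw [coprimI_apply, sub_self]

lemma JI_adjoint (a b : C(unitInterval, E)) :
    JI ℝ (inI (primI E a) b) = JI ℝ (inI a (coprimI E b)) := by
  have h := ftcI (inI (primI E a) (coprimI E b))
    (inI a (coprimI E b) - inI (primI E a) b) (fun s hs => by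
      have h1 := (hasDerivAt_primI a hs).inner ℝ (hasDerivAt_coprimI b hs)
      refine h1.congr_deriv ?_
      change _ = inner ℝ (extI a s) (extI (coprimI E b) s) - inner ℝ (extI (primI E a) s) (extI b s)
      rw [inner_neg_right]; ring)
  rw [map_sub] at h
  simp only [inI_apply, primI_zero, coprimI_one, inner_zero_left, inner_zero_right] at h
  linarith

lemma JI_inner_const (x : E) (b : C(unitInterval, E)) :
    JI ℝ (inI (constI E x) b) = inner ℝ x (JI E b) := by
  have := ftcI (inI (constI E x) (primI E b)) (inI (constI E x) b) (fun s hs => by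
      have h1 := (hasDerivAt_const s x).inner ℝ (hasDerivAt_primI b hs)
      refine h1.congr_deriv ?_
      change _ = inner ℝ x (extI b s) 
      rw [inner_zero_left, add_zero])
  rw [this]
  simp [JI]

lemma inI_comm (a b : C(unitInterval, E)) : inI a b = inI b a := by
  ext θ; simp [real_inner_comm]

lemma inI_add_left (a b c : C(unitInterval, E)) : inI (a + b) c = inI a c + inI b c := by
  ext θ; simp [inner_add_left]

lemma inI_sub_left (a b c : C(unitInterval, E)) : inI (a - b) c = inI a c - inI b c := by
  ext θ; simp [inner_sub_left]

lemma inI_sub_right (a b c : C(unitInterval, E)) : inI a (b - c) = inI a b - inI a c := by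
  ext θ; simp [inner_sub_right]

lemma inI_smul_left (r : ℝ) (a b : C(unitInterval, E)) : inI (r • a) b = r • inI a b := by
  ext θ; simp [inner_smul_left]

lemma inI_smul_right (r : ℝ) (a b : C(unitInterval, E)) : inI a (r • b) = r • inI a b := by
  ext θ; simp [inner_smul_right]

/-- Data for the eikonal equation in an abstract Hilbert space. -/
structure EikD (E : Type) [NormedAddCommGroup E] [InnerProductSpace ℝ E] where
  V : C(ℝ × E, ℝ)
  hV : ContDiff ℝ (⊤ : ℕ∞) V
  dV : C(ℝ × E, E)
  hdV : ContDiff ℝ (⊤ : ℕ∞) dV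
  dV_spec : ∀ p h, inner ℝ (dV p) h = fderiv ℝ V p (0, h)
  bV : ∀ j, 1 ≤ j → ∃ C, ∀ s : ℝ, |s| ≤ 1 → ∀ x, ‖iteratedFDeriv ℝ j (fun y => dV (s, y)) x‖ ≤ C
  φ : E → ℝ
  hφ : ContDiff ℝ (⊤ : ℕ∞) φ
  dφ : E → E
  dφ_spec : ∀ x h, inner ℝ (dφ x) h = fderiv ℝ φ x h
  bφ : BD (fun (_ : Unit) => dφ)

variable (D : EikD E)

lemma EikD.hdφ : ContDiff ℝ (⊤ : ℕ∞) D.dφ := D.bφ.smooth ()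

/-- The momentum along a curve. -/
def EikD.R (t : ℝ) (γ : C(unitInterval, E)) : C(unitInterval, E) :=
  constI E (D.dφ (γ 0)) - t • primI E (D.dV.comp (graphI E (t, γ)))

/-- The time derivative of the potential. -/
def EikD.Vt : C(ℝ × E, ℝ) := ⟨fun p => fderiv ℝ D.V p (1, 0), by
  have : ContDiff ℝ (⊤ : ℕ∞) (fderiv ℝ D.V) := D.hV.fderiv_right (by simp)
  exact this.continuous.clm_apply continuous_const⟩

lemma EikD.fderiv_V (p : ℝ × E) (q : ℝ × E) :
    fderiv ℝ D.V p q = q.1 * D.Vt p + inner ℝ (D.dV p) q.2 := by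
  have : q = q.1 • ((1 : ℝ), (0 : E)) + (0, q.2) := by ext <;> simp
  conv_lhs => rw [this]
  rw [map_add, map_smul, D.dV_spec]; rfl

/-- Half the squared norm of a curve. -/
def halfSq (w : C(unitInterval, E)) : C(unitInterval, ℝ) := (1 / 2 : ℝ) • inI w w

/-- multiplication by the parameter -/
def thetaMul (f : C(unitInterval, ℝ)) : C(unitInterval, ℝ) :=
  ⟨fun θ => (θ : ℝ) * f θ, by fun_prop⟩

/-- Derivative of `θ ↦ V(tθ, γ θ)`. -/
lemma EikD.hasDerivAt_V (t : ℝ) (γ w : C(unitInterval, E)) {s : ℝ}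
    (hγ : HasDerivAt (extI γ) (t • extI w s) s) (hs : s ∈ Ioo (0 : ℝ) 1) :
    HasDerivAt (extI (D.V.comp (graphI E (t, γ))))
      (t * D.Vt (t * s, extI γ s) + t * inner ℝ (D.dV (t * s, extI γ s)) (extI w s)) s := by
  have h1 : HasDerivAt (fun s : ℝ => (t * s, extI γ s)) (t * 1, t • extI w s) s :=
    ((hasDerivAt_id s).const_mul t).prodMk hγ
  have h2 := ((D.hV.differentiable (by simp)) (t * s, extI γ s)).hasFDerivAt.comp_hasDerivAt s h1
  rw [D.fderiv_V] at h2
  have h3 := h2.congr_of_eventuallyEq (f₁ := extI (D.V.comp (graphI E (t, γ)))) (by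
    filter_upwards [Icc_mem_nhds hs.1 hs.2] with r hr
    rw [extI_of_mem _ hr, Function.comp, extI_of_mem _ hr]
    rfl)
  refine h3.congr_deriv ?_
  simp [inner_smul_right]

lemma hasDerivAt_extI_curve {t : ℝ} {x : E} {γ w : C(unitInterval, E)}
    (hγ : γ = constI E x - t • coprimI E w) {s : ℝ} (hs : s ∈ Ioo (0 : ℝ) 1) :
    HasDerivAt (extI γ) (t • extI w s) s := by
  have h := ((hasDerivAt_coprimI w hs).const_smul t).const_sub x
  rw [hγ]
  refine HasDerivAt.congr_deriv (f' := -(t • -extI w s)) h ?_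
  simp

lemma EikD.hasDerivAt_extI_mom {t : ℝ} {γ w : C(unitInterval, E)}
    (hw : w = D.R t γ) {s : ℝ} (hs : s ∈ Ioo (0 : ℝ) 1) :
    HasDerivAt (extI w) (-(t • D.dV (t * s, extI γ s))) s := by
  have h := ((hasDerivAt_primI (D.dV.comp (graphI E (t, γ))) hs).const_smul t).const_sub
    (D.dφ (γ 0))
  rw [hw]
  refine HasDerivAt.congr_deriv (f' := -(t • extI (D.dV.comp (graphI E (t, γ))) s)) h ?_
  have hs' := Ioo_subset_Icc_self hs
  rw [extI_of_mem _ hs', extI_of_mem _ hs']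
  rfl

lemma EikD.energy {t : ℝ} {x : E} {γ w : C(unitInterval, E)}
    (hγ : γ = constI E x - t • coprimI E w) (hw : w = D.R t γ) :
    JI ℝ (halfSq w + D.V.comp (graphI E (t, γ)) +
      t • thetaMul (D.Vt.comp (graphI E (t, γ)))) = D.V (t, x) + 1 / 2 * inner ℝ (w 1) (w 1) := by
  have h := ftcI (thetaMul (D.V.comp (graphI E (t, γ)) + halfSq w))
    (halfSq w + D.V.comp (graphI E (t, γ)) + t • thetaMul (D.Vt.comp (graphI E (t, γ))))
    (fun s hs => by
      have hs' := Ioo_subset_Icc_self hs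
      have e1 := hasDerivAt_extI_curve hγ hs
      have e2 := D.hasDerivAt_extI_mom hw hs
      have e3 := D.hasDerivAt_V t γ w e1 hs
      have e4 := (hasDerivAt_id s).mul (e3.add ((e2.inner ℝ e2).const_mul (1 / 2 : ℝ)))
      have e5 := e4.congr_of_eventuallyEq
          (f₁ := extI (thetaMul (D.V.comp (graphI E (t, γ)) + halfSq w))) (by
        filter_upwards [Icc_mem_nhds hs.1 hs.2] with r hr
        simp only [Pi.mul_apply, Pi.add_apply, id]
        rw [extI_of_mem _ hr, extI_of_mem _ hr, extI_of_mem _ hr]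
        rfl)
      refine e5.congr_deriv ?_
      simp only [Pi.add_apply, id]
      rw [extI_of_mem _ hs', extI_of_mem _ hs', extI_of_mem _ hs', extI_of_mem _ hs']
      simp only [halfSq, thetaMul, ContinuousMap.add_apply, ContinuousMap.smul_apply,
        ContinuousMap.coe_mk, ContinuousMap.comp_apply, inI_apply, graphI_apply,
        inner_neg_left, inner_neg_right, inner_smul_left, inner_smul_right, smul_eq_mul]
      rw [real_inner_comm (D.dV (t * s, γ ⟨s, hs'⟩)) (w ⟨s, hs'⟩)]
      simp
      ring)
  rw [h]
  have hγ1 : γ 1 = x := by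
    rw [hγ]; simp [coprimI_one]
  simp [thetaMul, halfSq, hγ1]

end Action


section Action2

variable {E : Type} [NormedAddCommGroup E] [InnerProductSpace ℝ E] [CompleteSpace E]
variable (D : EikD E)

/-- Half the squared norm as a continuous map. -/
def hsq (E : Type) [NormedAddCommGroup E] [InnerProductSpace ℝ E] : C(E, ℝ) :=
  ⟨fun x => 1 / 2 * inner ℝ x x, by fun_prop⟩

lemma hsq_contDiff : ContDiff ℝ (⊤ : ℕ∞) (hsq E) := by
  change ContDiff ℝ (⊤ : ℕ∞) (fun x : E => 1 / 2 * inner ℝ x x)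
  exact contDiff_const.mul (contDiff_id.inner ℝ contDiff_id)

lemma halfSq_eq (w : C(unitInterval, E)) : halfSq w = (hsq E).comp w := by
  ext θ; simp [halfSq, hsq]

lemma halfSq_contDiff : ContDiff ℝ (⊤ : ℕ∞) (fun w : C(unitInterval, E) => halfSq w) := by
  have := nem_contDiff (K := unitInterval) (hsq E) hsq_contDiff
  rwa [← funext (fun w : C(unitInterval, E) => halfSq_eq w)] at this

lemma halfSq_hasDerivAt {w : ℝ → C(unitInterval, E)} {w' : C(unitInterval, E)} {u : ℝ}
    (hw : HasDerivAt w w' u) : HasDerivAt (fun u => halfSq (w u)) (inI (w u) w') u := by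
  let f' : C(E, Op E ℝ) := ⟨fun x => Op.mk E ℝ (innerSL ℝ x),
    (Op.mk E ℝ).continuous.comp (innerSL ℝ).continuous⟩
  have h1 := nem_hasFDerivAt (hsq E) f' (fun x => by
    have h := (hasStrictFDerivAt_norm_sq x).hasFDerivAt.const_mul (1 / 2 : ℝ)
    have e : (fun y : E => (1 / 2 : ℝ) * ‖y‖ ^ 2) = hsq E := by
      funext y; simp [hsq]
    rw [e] at h
    refine h.congr_fderiv ?_
    ext v
    change (1 / 2 : ℝ) * (2 • innerSL ℝ x) v = inner ℝ x v
    simp) (w u)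
  have h2 := h1.comp_hasDerivAt u hw
  have e : (fun u => halfSq (w u)) = (fun γ => (hsq E).comp γ) ∘ w := by
    funext u; exact halfSq_eq _
  rw [e]
  exact h2

lemma EikD.V_hasDerivAt {t : ℝ → ℝ} {γ : ℝ → C(unitInterval, E)} {τ : ℝ}
    {γ' : C(unitInterval, E)} {u : ℝ} (ht : HasDerivAt t τ u) (hγ : HasDerivAt γ γ' u) :
    HasDerivAt (fun u => D.V.comp (graphI E (t u, γ u)))
      (τ • thetaMul (D.Vt.comp (graphI E (t u, γ u))) +
        inI (D.dV.comp (graphI E (t u, γ u))) γ') u := by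
  have hd : Differentiable ℝ D.V := D.hV.differentiable (by simp)
  have hd' : ContDiff ℝ (⊤ : ℕ∞) (fderiv ℝ D.V) := D.hV.fderiv_right (by simp)
  let f' : C(ℝ × E, Op (ℝ × E) ℝ) :=
    ⟨fun x => Op.mk (ℝ × E) ℝ (fderiv ℝ D.V x), (Op.mk _ _).continuous.comp hd'.continuous⟩
  have h1 := nem_hasFDerivAt D.V f' (fun x => (hd x).hasFDerivAt) (graphI E (t u, γ u))
  have h2 := h1.comp_hasDerivAt u ((graphI E).hasFDerivAt.comp_hasDerivAt u (ht.prodMk hγ))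
  refine h2.congr_deriv ?_
  ext θ
  change fderiv ℝ D.V (t u * θ, γ u θ) (τ * θ, γ' θ) = τ * (θ * D.Vt (t u * θ, γ u θ)) +
    inner ℝ (D.dV (t u * θ, γ u θ)) (γ' θ)
  rw [D.fderiv_V]
  ring

/-- The action. -/
def EikD.act (t : ℝ) (γ w : C(unitInterval, E)) : ℝ :=
  D.φ (γ 0) + t * JI ℝ (halfSq w - D.V.comp (graphI E (t, γ)))

lemma EikD.act_hasDerivAt {t : ℝ → ℝ} {x : ℝ → E} {γ w : ℝ → C(unitInterval, E)} {τ : ℝ} {h : E}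
    {γ' w' : C(unitInterval, E)} {u : ℝ} (ht : HasDerivAt t τ u) (hx : HasDerivAt x h u)
    (hγ : HasDerivAt γ γ' u) (hw : HasDerivAt w w' u)
    (eγ : ∀ᶠ v in nhds u, γ v = constI E (x v) - t v • coprimI E (w v))
    (ew : w u = D.R (t u) (γ u)) :
    HasDerivAt (fun v => D.act (t v) (γ v) (w v))
      (inner ℝ (w u 1) h - τ * (D.V (t u, x u) + 1 / 2 * inner ℝ (w u 1) (w u 1))) u := by
  have a1 : HasDerivAt (fun v => γ v 0) (γ' 0) u := (evI E 0).hasFDerivAt.comp_hasDerivAt u hγ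
  have a2 := ((D.hφ.differentiable (by simp)) (γ u 0)).hasFDerivAt.comp_hasDerivAt u a1
  have a3 := (halfSq_hasDerivAt hw).sub (D.V_hasDerivAt ht hγ)
  have a4 := (JI ℝ).hasFDerivAt.comp_hasDerivAt u a3
  have a5 := a2.add (ht.mul a4)
  refine HasDerivAt.congr_deriv (f := fun v => D.act (t v) (γ v) (w v)) a5 ?_
  have b1 : γ' = constI E h - (t u • coprimI E w' + τ • coprimI E (w u)) := by
    have c1 := ((constI E).hasFDerivAt.comp_hasDerivAt u hx).sub
      (ht.smul ((coprimI E).hasFDerivAt.comp_hasDerivAt u hw))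
    exact hγ.unique (c1.congr_of_eventuallyEq eγ)
  have b2 := D.energy eγ.self_of_nhds ew
  set T := t u
  set G := γ u
  set ω := w u
  set v := D.dV.comp (graphI E (T, G)) with hv
  set p := D.dφ (G 0) with hp
  rw [← D.dφ_spec]
  have ew' : ω = constI E p - T • primI E v := ew
  have b3 : T * JI ℝ (inI ω w') = inner ℝ p h - τ * inner ℝ p (JI E ω) - inner ℝ p (γ' 0)
      - T * (inner ℝ (JI E v) h - τ * JI ℝ (inI v (coprimI E ω)) - JI ℝ (inI v γ')) := by
    have d1 : T • coprimI E w' = constI E h - τ • coprimI E ω - γ' := by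
      rw [b1]; abel
    have d2 : T • JI E w' = h - τ • JI E ω - γ' 0 := by
      have := congrArg (fun c : C(unitInterval, E) => c 0) d1
      simpa [coprimI_zero] using this
    calc T * JI ℝ (inI ω w') = inner ℝ p (T • JI E w') - T * JI ℝ (inI v (T • coprimI E w')) := by
          rw [ew', inI_sub_left, map_sub, JI_inner_const, inI_smul_left, map_smul, JI_adjoint,
            inI_smul_right, map_smul, inner_smul_right, smul_eq_mul]
          ring
      _ = _ := by
          rw [d1, d2, inI_sub_right, inI_sub_right, map_sub, map_sub, inI_comm v (constI E h),
            JI_inner_const, inI_smul_right, map_smul, smul_eq_mul, inner_sub_right,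
            inner_sub_right, inner_smul_right, real_inner_comm (JI E v) h]
  have b4 : JI ℝ (inI ω ω) = inner ℝ p (JI E ω) - T * JI ℝ (inI v (coprimI E ω)) := by
    conv_lhs => rw [ew', inI_sub_left, map_sub, ← ew', JI_inner_const, inI_smul_left, map_smul,
      JI_adjoint, smul_eq_mul]
  have b5 : inner ℝ (ω 1) h = inner ℝ p h - T * inner ℝ (JI E v) h := by
    rw [ew', ContinuousMap.sub_apply, constI_apply, ContinuousMap.smul_apply, inner_sub_left,
      inner_smul_left]
    rfl
  have b6 : JI ℝ (halfSq ω) = 1 / 2 * JI ℝ (inI ω ω) := by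
    rw [halfSq, map_smul, smul_eq_mul]
  rw [map_add, map_add, map_smul, smul_eq_mul, b6] at b2
  simp only [Function.comp, Pi.sub_apply]
  rw [map_sub, map_sub, map_add, map_smul, smul_eq_mul, ← b2, b5, b6]
  linear_combination b3 + τ * b4

lemma EikD.R_contDiff : ContDiff ℝ (⊤ : ℕ∞)
    (fun p : ℝ × C(unitInterval, E) => D.R p.1 p.2) := by
  unfold EikD.R
  have h1 : ContDiff ℝ (⊤ : ℕ∞) (fun p : ℝ × C(unitInterval, E) => D.dV.comp (graphI E p)) :=
    (nem_contDiff D.dV D.hdV).comp (graphI E).contDiff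
  have h2 : ContDiff ℝ (⊤ : ℕ∞) (fun p : ℝ × C(unitInterval, E) => p.2 0) :=
    (evI E 0).contDiff.comp contDiff_snd
  exact ((constI E).contDiff.comp (D.hdφ.comp h2)).sub
    (contDiff_fst.smul ((primI E).contDiff.comp h1))

lemma EikD.R_BD : BD (fun t : {t : ℝ // |t| ≤ 1} => D.R t) := by
  have h1 : BD (fun (_ : {t : ℝ // |t| ≤ 1}) (γ : C(unitInterval, E)) =>
      constI E (D.dφ (evI E 0 γ))) :=
    (BD.clm (constI E)).comp ((D.bφ.reindex (fun _ => ())).comp (BD.clm (evI E 0)))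
  have h2 : BD (fun (t : {t : ℝ // |t| ≤ 1}) (γ : C(unitInterval, E)) =>
      D.dV.comp (graphI E ((t : ℝ), γ))) := by
    refine ⟨fun t => ?_, fun k hk => ?_⟩
    · exact (nem_contDiff D.dV D.hdV).comp
        ((graphI E).contDiff.comp (contDiff_const.prodMk contDiff_id))
    · obtain ⟨C, hC⟩ := D.bV k hk
      exact ⟨C, fun t γ => nem_slab_bound k D.dV D.hdV C hC t t.2 γ⟩
  exact h1.sub ((((BD.clm (primI E)).comp h2)).smul (fun t => (t : ℝ)) (fun t => t.2))

/-- Solution of the characteristics boundary value problem. -/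
lemma EikD.char_exists : ∃ T0 > 0, T0 ≤ 1 ∧ ∃ γ w : ℝ → E → C(unitInterval, E),
    ContDiffOn ℝ (⊤ : ℕ∞) (fun p : ℝ × E => γ p.1 p.2) (Ioo (-T0) T0 ×ˢ univ) ∧
    ContDiffOn ℝ (⊤ : ℕ∞) (fun p : ℝ × E => w p.1 p.2) (Ioo (-T0) T0 ×ˢ univ) ∧
    (∀ t ∈ Ioo (-T0) T0, ∀ x, γ t x = constI E x - t • coprimI E (w t x)) ∧
    (∀ t x, w t x = D.R t (γ t x)) ∧
    BD (fun t : Ioo (-T0) T0 => w t) := by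
  have hS : ContDiff ℝ (⊤ : ℕ∞) (fun p : ℝ × C(unitInterval, E) => coprimI E (D.R p.1 p.2)) :=
    (coprimI E).contDiff.comp D.R_contDiff
  obtain ⟨T0, h0, h1, g, g1, g2, g3⟩ := global_inverse (fun t γ => coprimI E (D.R t γ)) hS
    ((BD.clm (coprimI E)).comp D.R_BD)
  have hγ : ContDiffOn ℝ (⊤ : ℕ∞) (fun p : ℝ × E => g p.1 (constI E p.2))
      (Ioo (-T0) T0 ×ˢ univ) := by
    have h : ContDiff ℝ (⊤ : ℕ∞) (fun p : ℝ × E => (p.1, constI E p.2)) :=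
      contDiff_fst.prodMk ((constI E).contDiff.comp contDiff_snd)
    exact g1.comp h.contDiffOn (fun p hp => ⟨hp.1, trivial⟩)
  refine ⟨T0, h0, h1, fun t x => g t (constI E x), fun t x => D.R t (g t (constI E x)), hγ, ?_,
    ?_, fun _ _ => rfl, ?_⟩
  · exact D.R_contDiff.comp_contDiffOn (contDiff_fst.contDiffOn.prodMk hγ)
  · intro t ht x
    have := g2 t ht (constI E x)
    rw [← this]; simp
  · have hle : ∀ t : Ioo (-T0) T0, |(t : ℝ)| ≤ 1 := fun t =>
      (abs_lt.2 t.2).le.trans h1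
    exact (D.R_BD.reindex (fun t : Ioo (-T0) T0 => ⟨t, hle t⟩)).comp
      (g3.comp (BD.clm (constI E)))

end Action2


section Solution

variable {E : Type} [NormedAddCommGroup E] [InnerProductSpace ℝ E] [CompleteSpace E]
variable (D : EikD E)

lemma EikD.exists_sol : ∃ T0 > 0, T0 ≤ 1 ∧ ∃ γ w : ℝ → E → C(unitInterval, E),
    (∀ t ∈ Ioo (-T0) T0, ∀ x, γ t x = constI E x - t • coprimI E (w t x)) ∧
    (∀ t x, w t x = D.R t (γ t x)) ∧
    ContDiffOn ℝ (⊤ : ℕ∞) (fun p : ℝ × E => D.act p.1 (γ p.1 p.2) (w p.1 p.2))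
      (Ioo (-T0) T0 ×ˢ univ) ∧
    (∀ t ∈ Ioo (-T0) T0, ∀ x, HasDerivAt (fun s => D.act s (γ s x) (w s x))
      (-(D.V (t, x) + 1 / 2 * inner ℝ (w t x 1) (w t x 1))) t) ∧
    (∀ t ∈ Ioo (-T0) T0, ∀ x, fderiv ℝ (fun y => D.act t (γ t y) (w t y)) x =
      innerSL ℝ (w t x 1)) ∧
    (∀ x, D.act 0 (γ 0 x) (w 0 x) = D.φ x) ∧
    (∀ k, 2 ≤ k → ∃ C, ∀ t ∈ Ioo (-T0) T0, ∀ x,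
      ‖iteratedFDeriv ℝ k (fun y => D.act t (γ t y) (w t y)) x‖ ≤ C) := by
  obtain ⟨T0, h0, h1, γ, w, sγ, sw, eγ, ew, bw⟩ := D.char_exists
  have hopen : ∀ t ∈ Ioo (-T0) T0, ∀ x : E, Ioo (-T0) T0 ×ˢ (univ : Set E) ∈ nhds (t, x) :=
    fun t ht x => prod_mem_nhds (Ioo_mem_nhds ht.1 ht.2) univ_mem
  have sφ : ContDiffOn ℝ (⊤ : ℕ∞) (fun p : ℝ × E => D.act p.1 (γ p.1 p.2) (w p.1 p.2))
      (Ioo (-T0) T0 ×ˢ univ) := by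
    unfold EikD.act
    have c1 : ContDiffOn ℝ (⊤ : ℕ∞) (fun p : ℝ × E => D.φ (γ p.1 p.2 0))
        (Ioo (-T0) T0 ×ˢ univ) :=
      (D.hφ.comp (evI E 0).contDiff).comp_contDiffOn sγ
    have c2 : ContDiffOn ℝ (⊤ : ℕ∞) (fun p : ℝ × E => halfSq (w p.1 p.2))
        (Ioo (-T0) T0 ×ˢ univ) := halfSq_contDiff.comp_contDiffOn sw
    have c3 : ContDiffOn ℝ (⊤ : ℕ∞) (fun p : ℝ × E => D.V.comp (graphI E (p.1, γ p.1 p.2)))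
        (Ioo (-T0) T0 ×ˢ univ) :=
      ((nem_contDiff D.V D.hV).comp (graphI E).contDiff).comp_contDiffOn
        (contDiff_fst.contDiffOn.prodMk sγ)
    exact c1.add (contDiff_fst.contDiffOn.mul ((JI ℝ).contDiff.comp_contDiffOn (c2.sub c3)))
  have dγ : ∀ t ∈ Ioo (-T0) T0, ∀ x, DifferentiableAt ℝ (fun p : ℝ × E => γ p.1 p.2) (t, x) :=
    fun t ht x => (sγ.contDiffAt (hopen t ht x)).differentiableAt (by simp)
  have dw : ∀ t ∈ Ioo (-T0) T0, ∀ x, DifferentiableAt ℝ (fun p : ℝ × E => w p.1 p.2) (t, x) :=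
    fun t ht x => (sw.contDiffAt (hopen t ht x)).differentiableAt (by simp)
  have dφ : ∀ t ∈ Ioo (-T0) T0, ∀ x, DifferentiableAt ℝ
      (fun p : ℝ × E => D.act p.1 (γ p.1 p.2) (w p.1 p.2)) (t, x) :=
    fun t ht x => (sφ.contDiffAt (hopen t ht x)).differentiableAt (by simp)
  have hfd : ∀ t ∈ Ioo (-T0) T0, ∀ x, fderiv ℝ (fun y => D.act t (γ t y) (w t y)) x =
      innerSL ℝ (w t x 1) := by
    intro t ht x
    ext h
    have k0 : HasDerivAt (fun u : ℝ => x + u • h) h 0 := by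
      simpa using ((hasDerivAt_id (0 : ℝ)).smul_const h).const_add x
    have k1 : HasDerivAt (fun u : ℝ => (t, x + u • h)) (0, h) 0 :=
      (hasDerivAt_const (0 : ℝ) t).prodMk k0
    have hz : x + (0 : ℝ) • h = x := by simp
    have k2 :=
      HasFDerivAt.comp_hasDerivAt_of_eq (0 : ℝ) (dγ t ht x).hasFDerivAt k1 (by simp)
    have k3 :=
      HasFDerivAt.comp_hasDerivAt_of_eq (0 : ℝ) (dw t ht x).hasFDerivAt k1 (by simp)
    have k4 := D.act_hasDerivAt (γ := fun u : ℝ => γ t (x + u • h)) (w := fun u : ℝ => w t (x + u • h))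
      (hasDerivAt_const (0 : ℝ) t) k0 k2 k3
      (Eventually.of_forall fun v => eγ t ht _) (ew _ _)
    have k5 : DifferentiableAt ℝ (fun y => D.act t (γ t y) (w t y)) x :=
      DifferentiableAt.comp x (f := fun y => (t, y)) (dφ t ht x)
        (hasFDerivAt_prodMk_right t x).differentiableAt
    have k6:=
      HasFDerivAt.comp_hasDerivAt_of_eq (0 : ℝ) k5.hasFDerivAt k0 hz.symm
    have k7 := k6.unique k4
    rw [k7]
    simp
  refine ⟨T0, h0, h1, γ, w, eγ, ew, sφ, ?_, hfd, ?_, ?_⟩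
  · intro t ht x
    have k1 : HasDerivAt (fun u : ℝ => (u, x)) (1, 0) t :=
      (hasDerivAt_id t).prodMk (hasDerivAt_const t x)
    have k2 :=
      (dγ t ht x).hasFDerivAt.comp_hasDerivAt t k1
    have k3 :=
      (dw t ht x).hasFDerivAt.comp_hasDerivAt t k1
    have k4 := D.act_hasDerivAt (γ := fun u : ℝ => γ u x) (w := fun u : ℝ => w u x)
      (hasDerivAt_id t) (hasDerivAt_const t x) k2 k3
      (by filter_upwards [Ioo_mem_nhds ht.1 ht.2] with v hv using eγ v hv _) (ew _ _)
    refine k4.congr_deriv ?_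
    simp
  · intro x
    have : γ 0 x = constI E x := by
      rw [eγ 0 ⟨by linarith, h0⟩ x]; simp
    rw [EikD.act, this]
    simp
  · intro k hk
    obtain ⟨m, rfl⟩ : ∃ m, k = m + 1 := ⟨k - 1, by omega⟩
    have hb : BD (fun (t : Ioo (-T0) T0) x => innerSL ℝ (evI E 1 (w t x))) :=
      (BD.clm (innerSL ℝ)).comp ((BD.clm (evI E 1)).comp bw)
    obtain ⟨C, hC⟩ := hb.bdd m (by omega)
    refine ⟨C, fun t ht x => ?_⟩
    rw [← norm_iteratedFDeriv_fderiv, funext (hfd t ht)]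
    exact hC ⟨t, ht⟩ x

end Solution


section Unique

variable {E : Type} [NormedAddCommGroup E] [InnerProductSpace ℝ E] [CompleteSpace E]
variable (D : EikD E)

/-- Riesz representation as a continuous linear map. -/
def sharp (E : Type) [NormedAddCommGroup E] [InnerProductSpace ℝ E] [CompleteSpace E] :
    (E →L[ℝ] ℝ) →L[ℝ] E :=
  LinearMap.mkContinuous
    { toFun := fun l => (InnerProductSpace.toDual ℝ E).symm l
      map_add' := by intro a b; simp
      map_smul' := by intro c a; simp } 1 (by intro l; simp)

lemma inner_sharp (l : E →L[ℝ] ℝ) (h : E) : inner ℝ (sharp E l) h = l h :=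
  InnerProductSpace.toDual_symm_apply

lemma sharp_innerSL (x : E) : sharp E (innerSL ℝ x) = x := by
  refine ext_inner_right ℝ fun v => ?_
  rw [inner_sharp]; rfl

lemma eq_zero_of_gronwall {q q' : ℝ → E} {M : ℝ} (hc : ContinuousOn q (Icc 0 1))
    (hd : ∀ s ∈ Ioo (0 : ℝ) 1, HasDerivAt q (q' s) s)
    (hM : ∀ s ∈ Ioo (0 : ℝ) 1, ‖q' s‖ ≤ M * ‖q s‖) (h0 : q 0 = 0) :
    ∀ s ∈ Icc (0 : ℝ) 1, q s = 0 := by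
  have hder : ∀ s ∈ Ioo (0 : ℝ) 1, HasDerivAt
      (fun s => Real.exp (-(2 * M) * s) * inner ℝ (q s) (q s))
      (Real.exp (-(2 * M) * s) * (-(2 * M) * 1) * inner ℝ (q s) (q s) +
        Real.exp (-(2 * M) * s) * (inner ℝ (q s) (q' s) + inner ℝ (q' s) (q s))) s := by
    intro s hs
    exact (((hasDerivAt_id s).const_mul (-(2 * M))).exp).mul ((hd s hs).inner ℝ (hd s hs))
  have hanti : AntitoneOn (fun s => Real.exp (-(2 * M) * s) * inner ℝ (q s) (q s))
      (Icc (0 : ℝ) 1) := by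
    refine antitoneOn_of_deriv_nonpos (convex_Icc 0 1) ?_ ?_ ?_
    · exact ContinuousOn.mul (by fun_prop) (hc.inner hc)
    · rw [interior_Icc]
      exact fun s hs => (hder s hs).differentiableAt.differentiableWithinAt
    · rw [interior_Icc]
      intro s hs
      rw [(hder s hs).deriv, real_inner_comm (q s) (q' s), real_inner_self_eq_norm_sq]
      have h1 : inner ℝ (q s) (q' s) ≤ M * ‖q s‖ ^ 2 := by
        refine (real_inner_le_norm _ _).trans ?_
        have := mul_le_mul_of_nonneg_left (hM s hs) (norm_nonneg (q s))
        nlinarith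
      have h2 := Real.exp_pos (-(2 * M) * s)
      nlinarith [mul_le_mul_of_nonneg_left h1 h2.le]
  intro s hs
  have h := hanti (left_mem_Icc.2 zero_le_one) hs hs.1
  simp only [h0, inner_zero_left, mul_zero] at h
  have h2 := Real.exp_pos (-(2 * M) * s)
  have h3 : inner ℝ (q s) (q s) ≤ 0 := by
    by_contra hcon
    push Not at hcon
    have := mul_pos h2 hcon
    linarith
  rw [real_inner_self_eq_norm_sq] at h3
  have h4 := pow_eq_zero_iff (two_ne_zero) |>.1 (le_antisymm h3 (sq_nonneg ‖q s‖))
  exact norm_eq_zero.1 h4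

lemma clm_comp_hasFDerivAt {X : Type} (Y : Type) {Z : Type} [NormedAddCommGroup X]
    [NormedSpace ℝ X] [NormedAddCommGroup Y] [NormedSpace ℝ Y] [NormedAddCommGroup Z]
    [NormedSpace ℝ Z] (K : Y →L[ℝ] Z) {f : X → Y} {f' : X →L[ℝ] Y} {p : X}
    (hf : HasFDerivAt f f' p) : HasFDerivAt (fun r => K (f r)) (K.comp f') p :=
  K.hasFDerivAt.comp p hf

lemma clm_comp_contDiffOn {X : Type} (Y : Type) {Z : Type} [NormedAddCommGroup X]
    [NormedSpace ℝ X] [NormedAddCommGroup Y] [NormedSpace ℝ Y] [NormedAddCommGroup Z]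
    [NormedSpace ℝ Z] (K : Y →L[ℝ] Z) {f : X → Y} {s : Set X}
    (hf : ContDiffOn ℝ (⊤ : ℕ∞) f s) : ContDiffOn ℝ (⊤ : ℕ∞) (fun r => K (f r)) s :=
  K.contDiff.comp_contDiffOn hf

lemma comp_curve_hasDerivAt {X : Type} (Y : Type) [NormedAddCommGroup X]
    [NormedSpace ℝ X] [NormedAddCommGroup Y] [NormedSpace ℝ Y] {f : X → Y} {f' : X →L[ℝ] Y} {p : X}
    (hf : HasFDerivAt f f' p) {c : ℝ → X} {c' : X} {u : ℝ} (hc : HasDerivAt c c' u) (h : p = c u) :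
    HasDerivAt (fun r => f (c r)) (f' c') u :=
  HasFDerivAt.comp_hasDerivAt_of_eq u hf hc h

lemma EikD.unique {T : ℝ} (hT : 0 < T) {ψ : ℝ → E → ℝ}
    (hψ : ContDiffOn ℝ (⊤ : ℕ∞) (fun p : ℝ × E => ψ p.1 p.2) (Icc (0 : ℝ) T ×ˢ univ))
    (heq : ∀ t ∈ Icc (0 : ℝ) T, ∀ x, deriv (fun s => ψ s x) t +
      1 / 2 * inner ℝ (sharp E (fderiv ℝ (ψ t) x)) (sharp E (fderiv ℝ (ψ t) x)) + D.V (t, x) = 0)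
    (hinit : ∀ x, ψ 0 x = D.φ x) {t0 : ℝ} (ht0 : t0 ∈ Icc 0 T) {x0 : E} {γ w : C(unitInterval, E)}
    (hγ : γ = constI E x0 - t0 • coprimI E w) (hw : w = D.R t0 γ) :
    ψ t0 x0 = D.act t0 γ w := by
  have hγ1 : γ 1 = x0 := by
    rw [hγ]; simp [coprimI_one]
  rcases ht0.1.eq_or_lt with h00 | hpos
  · have : γ = constI E x0 := by rw [hγ, ← h00]; simp
    rw [EikD.act, this, ← h00, hinit]; simp
  set Q : Set (ℝ × E) := Icc (0 : ℝ) T ×ˢ univ with hQ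
  set Ψ : ℝ × E → ℝ := fun p => ψ p.1 p.2 with hΨ
  have hu : UniqueDiffOn ℝ Q := (uniqueDiffOn_Icc hT).prod uniqueDiffOn_univ
  have hD : ContDiffOn ℝ (⊤ : ℕ∞) (fderivWithin ℝ Ψ Q) Q := hψ.fderivWithin hu (by simp)
  let ir : E →L[ℝ] ℝ × E := ContinuousLinearMap.inr ℝ ℝ E
  let K : (ℝ × E →L[ℝ] ℝ) →L[ℝ] E :=
    (sharp E).comp ((ContinuousLinearMap.compL ℝ E (ℝ × E) ℝ).flip ir)
  have hK : ∀ l h, inner ℝ (K l) h = l (0, h) := fun l h => inner_sharp _ _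
  let P : ℝ × E → E := fun p => K (fderivWithin ℝ Ψ Q p)
  have hP : ContDiffOn ℝ (⊤ : ℕ∞) P Q :=
    clm_comp_contDiffOn (ℝ × E →L[ℝ] ℝ) K hD
  have hDP : ContDiffOn ℝ (⊤ : ℕ∞) (fderivWithin ℝ P Q) Q := hP.fderivWithin hu (by simp)
  have hslice : ∀ t ∈ Icc (0 : ℝ) T, ∀ x,
      fderiv ℝ (ψ t) x = (fderivWithin ℝ Ψ Q (t, x)).comp ir := by
    intro t ht x
    have h1 : HasFDerivWithinAt Ψ (fderivWithin ℝ Ψ Q (t, x)) Q (t, x) :=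
      (hψ.differentiableOn (by simp) (t, x) ⟨ht, trivial⟩).hasFDerivWithinAt
    have h2 := h1.comp x ((hasFDerivAt_prodMk_right t x).hasFDerivWithinAt (s := univ))
      (fun y _ => ⟨ht, trivial⟩)
    exact (hasFDerivWithinAt_univ.1 h2).fderiv
  have hPs : ∀ t ∈ Icc (0 : ℝ) T, ∀ x, sharp E (fderiv ℝ (ψ t) x) = P (t, x) := by
    intro t ht x
    rw [hslice t ht x]; rfl
  have hnhds : ∀ p : ℝ × E, p.1 ∈ Ioo 0 T → Q ∈ nhds p := fun p hp =>
    prod_mem_nhds (Icc_mem_nhds hp.1 hp.2) univ_mem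
  -- the equation in terms of the full derivative
  have hpde : ∀ p : ℝ × E, p.1 ∈ Ioo 0 T →
      fderivWithin ℝ Ψ Q p (1, 0) + 1 / 2 * inner ℝ (P p) (P p) + D.V p = 0 := by
    rintro ⟨t, x⟩ hp
    have h := heq t (Ioo_subset_Icc_self hp) x
    rw [hPs t (Ioo_subset_Icc_self hp) x] at h
    have h1 : HasFDerivAt Ψ (fderivWithin ℝ Ψ Q (t, x)) (t, x) :=
      (hψ.differentiableOn (by simp) (t, x)
        ⟨Ioo_subset_Icc_self hp, trivial⟩).hasFDerivWithinAt.hasFDerivAt (hnhds _ hp)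
    have k1 : HasDerivAt (fun u : ℝ => (u, x)) (1, 0) t :=
      (hasDerivAt_id t).prodMk (hasDerivAt_const t x)
    have h2 := (h1.comp_hasDerivAt t k1).deriv
    rw [← h2]
    exact h
  -- derivative of the equation
  have hkey : ∀ p : ℝ × E, p.1 ∈ Ioo 0 T → ∀ ω : E,
      fderivWithin ℝ P Q p (1, ω) + D.dV p = -fderivWithin ℝ P Q p (0, P p - ω) := by
    intro p hp ω
    have hpQ := hnhds p hp
    have hmem : p ∈ Q := mem_of_mem_nhds hpQ
    have d1 : HasFDerivAt (fderivWithin ℝ Ψ Q) (fderiv ℝ (fderivWithin ℝ Ψ Q) p) p :=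
      ((hD.contDiffAt hpQ).differentiableAt (by simp)).hasFDerivAt
    have ePQ : fderivWithin ℝ P Q p = K.comp (fderiv ℝ (fderivWithin ℝ Ψ Q) p) := by
      rw [fderivWithin_of_mem_nhds hpQ]
      exact (clm_comp_hasFDerivAt (ℝ × E →L[ℝ] ℝ) K d1).fderiv
    have hev : fderivWithin ℝ Ψ Q =ᶠ[nhds p] fderiv ℝ Ψ := by
      have : ∀ᶠ r in nhds p, Q ∈ nhds r := eventually_mem_nhds_iff.2 hpQ
      filter_upwards [this] with r hr using fderivWithin_of_mem_nhds hr
    have hsym : ∀ a b, fderiv ℝ (fderivWithin ℝ Ψ Q) p a b =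
        fderiv ℝ (fderivWithin ℝ Ψ Q) p b a := by
      rw [hev.fderiv_eq]
      intro a b
      exact ((hψ.contDiffAt hpQ).isSymmSndFDerivAt
        (by rw [minSmoothness_of_isRCLikeNormedField]; exact WithTop.coe_le_coe.2 le_top)).eq a b
    set B := fderiv ℝ (fderivWithin ℝ Ψ Q) p with hB
    have d2 : HasFDerivAt P (K.comp B) p := clm_comp_hasFDerivAt (ℝ × E →L[ℝ] ℝ) K d1
    refine ext_inner_right ℝ fun h => ?_
    have k1 : HasDerivAt (fun u : ℝ => p + u • ((0 : ℝ), h)) (0, h) 0 := by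
      simpa using ((hasDerivAt_id (0 : ℝ)).smul_const ((0 : ℝ), h)).const_add p
    have k0 : p = p + (0 : ℝ) • ((0 : ℝ), h) := by simp
    have k2 := comp_curve_hasDerivAt (ℝ × E →L[ℝ] ℝ) d1 k1 k0
    have k3 := comp_curve_hasDerivAt E d2 k1 k0
    have k4 := comp_curve_hasDerivAt ℝ
      ((D.hV.differentiable (by simp)) p).hasFDerivAt k1 k0
    have k5 := ((k2.clm_apply (hasDerivAt_const (0 : ℝ) ((1 : ℝ), (0 : E)))).add
      ((k3.inner ℝ k3).const_mul (1 / 2 : ℝ))).add k4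
    have k6 := k5.congr_of_eventuallyEq (f₁ := fun _ => (0 : ℝ)) (by
      have : ∀ᶠ u : ℝ in nhds 0, (p + u • ((0 : ℝ), h)).1 ∈ Ioo 0 T := by
        simp only [Prod.fst_add, Prod.smul_fst, smul_zero, add_zero]
        exact Eventually.of_forall fun _ => hp
      filter_upwards [this] with u hu
      exact (hpde _ hu).symm)
    have k7 := k6.unique (hasDerivAt_const _ _)
    simp only [Function.comp, ← k0, map_zero, add_zero, ← D.dV_spec,
      ContinuousLinearMap.comp_apply] at k7
    rw [real_inner_comm _ (P p), hK] at k7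
    have eK : ∀ a, fderivWithin ℝ P Q p a = K (B a) := fun a => by rw [ePQ]; rfl
    rw [eK, eK, inner_add_left, inner_neg_left, hK, hK, hsym (1, ω), hsym (0, P p - ω)]
    have e1 : ((1 : ℝ), ω) = (1, 0) + (0, ω) := by simp
    have e2 : ((0 : ℝ), P p - ω) = (0, P p) - (0, ω) := by simp
    rw [e1, e2, map_add, map_sub]
    linarith
  -- along the characteristic
  have hcmem : ∀ s ∈ Icc (0 : ℝ) 1, (t0 * s, extI γ s) ∈ Q := fun s hs =>
    ⟨⟨mul_nonneg hpos.le hs.1, (mul_le_of_le_one_right hpos.le hs.2).trans ht0.2⟩, trivial⟩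
  have hcint : ∀ s ∈ Ioo (0 : ℝ) 1, t0 * s ∈ Ioo 0 T := fun s hs =>
    ⟨mul_pos hpos hs.1, (mul_lt_of_lt_one_right hpos hs.2).trans_le ht0.2⟩
  have hccont : ContinuousOn (fun s : ℝ => (t0 * s, extI γ s)) (Icc 0 1) :=
    ((continuous_const.mul continuous_id).prodMk (extI_continuous γ)).continuousOn
  have hcder : ∀ s ∈ Ioo (0 : ℝ) 1,
      HasDerivAt (fun s : ℝ => (t0 * s, extI γ s)) (t0 • ((1 : ℝ), extI w s)) s := by
    intro s hs
    have := ((hasDerivAt_id s).const_mul t0).prodMk (hasDerivAt_extI_curve hγ hs)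
    refine this.congr_deriv ?_
    simp
  have hDPc : ContinuousOn (fun s : ℝ => fderivWithin ℝ P Q (t0 * s, extI γ s)) (Icc 0 1) :=
    hDP.continuousOn.comp hccont hcmem
  have hDPn : ContinuousOn (fun s : ℝ => ‖fderivWithin ℝ P Q (t0 * s, extI γ s)‖) (Icc 0 1) :=
    ContinuousOn.norm (E := ℝ × E →L[ℝ] E) hDPc
  obtain ⟨M, hM'⟩ := isCompact_Icc.exists_bound_of_continuousOn hDPn
  have hM : ∀ s ∈ Icc (0 : ℝ) 1, ‖fderivWithin ℝ P Q (t0 * s, extI γ s)‖ ≤ M := by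
    intro s hs
    have := hM' s hs
    exact (le_abs_self _).trans this
  have hM0 : 0 ≤ M := (ContinuousLinearMap.opNorm_nonneg _).trans (hM 0 (by simp))
  have e0 : ∀ f : C(unitInterval, E), extI f 0 = f 0 := fun f => extI_coe f 0
  have e1 : ∀ f : C(unitInterval, E), extI f 1 = f 1 := fun f => extI_coe f 1
  have hq := eq_zero_of_gronwall (q := fun s => P (t0 * s, extI γ s) - extI w s)
    (q' := fun s => -(t0 • fderivWithin ℝ P Q (t0 * s, extI γ s)
      (0, P (t0 * s, extI γ s) - extI w s))) (M := t0 * M)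
    ((hP.continuousOn.comp hccont hcmem).sub (extI_continuous w).continuousOn)
    (by
      intro s hs
      have hpQ := hnhds (t0 * s, extI γ s) (hcint s hs)
      have d2 : HasFDerivAt P (fderivWithin ℝ P Q (t0 * s, extI γ s)) (t0 * s, extI γ s) :=
        (hP.differentiableOn (by simp) _ (mem_of_mem_nhds hpQ)).hasFDerivWithinAt.hasFDerivAt hpQ
      have d3 := (d2.comp_hasDerivAt s (hcder s hs)).sub (D.hasDerivAt_extI_mom hw hs)
      refine d3.congr_deriv ?_
      rw [map_smul, sub_neg_eq_add, ← smul_add, hkey _ (hcint s hs), smul_neg])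
    (by
      intro s hs
      have hs' := Ioo_subset_Icc_self hs
      rw [norm_neg, norm_smul, Real.norm_of_nonneg hpos.le, mul_assoc]
      refine mul_le_mul_of_nonneg_left ?_ hpos.le
      refine (ContinuousLinearMap.le_opNorm _ _).trans ?_
      refine mul_le_mul (hM s hs') ?_ (norm_nonneg _) hM0
      rw [Prod.norm_def]
      simp)
    (by
      rw [e0, e0, mul_zero, ← hPs 0 ⟨le_rfl, hT.le⟩, funext hinit, hw, sub_eq_zero]
      refine ext_inner_right ℝ fun h => ?_
      rw [inner_sharp, ← D.dφ_spec]
      simp [EikD.R])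
  have hfin := intervalIntegral.integral_eq_sub_of_hasDerivAt_of_le
    (f := fun s => Ψ (t0 * s, extI γ s))
    (f' := fun s => t0 * extI (halfSq w - D.V.comp (graphI E (t0, γ))) s) zero_le_one
    (hψ.continuousOn.comp hccont hcmem)
    (by
      intro s hs
      have hs' := Ioo_subset_Icc_self hs
      have hpQ := hnhds (t0 * s, extI γ s) (hcint s hs)
      have d2 : HasFDerivAt Ψ (fderivWithin ℝ Ψ Q (t0 * s, extI γ s)) (t0 * s, extI γ s) :=
        (hψ.differentiableOn (by simp) _ (mem_of_mem_nhds hpQ)).hasFDerivWithinAt.hasFDerivAt hpQ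
      refine (d2.comp_hasDerivAt s (hcder s hs)).congr_deriv ?_
      have h1 := hpde (t0 * s, extI γ s) (hcint s hs)
      have h2 : P (t0 * s, extI γ s) = extI w s := sub_eq_zero.1 (hq s hs')
      have h3 := hK (fderivWithin ℝ Ψ Q (t0 * s, extI γ s)) (extI w s)
      have h4 : inner ℝ (P (t0 * s, extI γ s)) (extI w s) =
        fderivWithin ℝ Ψ Q (t0 * s, extI γ s) (0, extI w s) := h3
      have e1 : ((1 : ℝ), extI w s) = (1, 0) + (0, extI w s) := by simp
      have h5 : extI (halfSq w - D.V.comp (graphI E (t0, γ))) s =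
          1 / 2 * inner ℝ (extI w s) (extI w s) - D.V (t0 * s, extI γ s) := by
        rw [extI_of_mem _ hs', extI_of_mem _ hs', extI_of_mem _ hs']
        simp [halfSq]
      rw [map_smul, smul_eq_mul, e1, map_add, ← h4, h5]
      rw [h2] at h1 ⊢
      congr 1
      linarith)
    ((continuous_const.mul (extI_continuous _)).intervalIntegrable _ _)
  rw [intervalIntegral.integral_const_mul, ← JI_eq] at hfin
  simp only [hΨ, e0, e1, mul_one, mul_zero, hγ1, hinit] at hfin
  rw [EikD.act, hfin]
  ring

end Unique


section Final

variable {n : ℕ}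

lemma gdotR_eq (f : Esp n → ℝ) (x : Esp n) :
    gdotR f f x = inner ℝ (sharp (Esp n) (fderiv ℝ f x)) (sharp (Esp n) (fderiv ℝ f x)) := by
  have h : ∀ i, sharp (Esp n) (fderiv ℝ f x) i = pd f i x := by
    intro i
    rw [pd, ← inner_sharp, evec, EuclideanSpace.inner_single_right]
    simp
  rw [real_inner_self_eq_norm_sq, EuclideanSpace.norm_sq_eq, gdotR]
  refine Finset.sum_congr rfl fun i _ => ?_
  rw [h, Real.norm_eq_abs, sq_abs, sq]

lemma sharp_bound {E : Type} [NormedAddCommGroup E] [InnerProductSpace ℝ E] [CompleteSpace E]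
    {f : E → ℝ} (hf : ContDiff ℝ (⊤ : ℕ∞) f) (j : ℕ) {x : E} {C : ℝ}
    (hC : ‖iteratedFDeriv ℝ (j + 1) f x‖ ≤ C) :
    ‖iteratedFDeriv ℝ j (fun y => sharp E (fderiv ℝ f y)) x‖ ≤ C := by
  rw [← norm_iteratedFDeriv_fderiv] at hC
  have h1 : ‖sharp E‖ ≤ 1 := LinearMap.mkContinuous_norm_le _ zero_le_one _
  have h2 : ContDiff ℝ (⊤ : ℕ∞) (fderiv ℝ f) := hf.fderiv_right (by simp)
  exact (((sharp E).norm_iteratedFDeriv_comp_left h2.contDiffAt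
    (n := j) (by exact_mod_cast le_top)).trans
    (mul_le_of_le_one_left (norm_nonneg _) h1)).trans hC

/-- The eikonal data attached to the geometrical assumption. -/
def geomData (V : ℝ → Esp n → ℝ) (φ0 : Esp n → ℝ) (h : GeomAssump n V φ0) : EikD (Esp n) where
  V := ⟨fun p => V p.1 p.2, h.smoothV.continuous⟩
  hV := h.smoothV
  dV := ⟨fun p => sharp (Esp n) ((fderiv ℝ (fun p : ℝ × Esp n => V p.1 p.2) p).comp
      (ContinuousLinearMap.inr ℝ ℝ (Esp n))), by
    have h1 : ContDiff ℝ (⊤ : ℕ∞) (fderiv ℝ (fun p : ℝ × Esp n => V p.1 p.2)) :=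
      h.smoothV.fderiv_right (by simp)
    exact ((sharp (Esp n)).contDiff.comp (h1.clm_comp contDiff_const)).continuous⟩
  hdV := by
    have h1 : ContDiff ℝ (⊤ : ℕ∞) (fderiv ℝ (fun p : ℝ × Esp n => V p.1 p.2)) :=
      h.smoothV.fderiv_right (by simp)
    exact (sharp (Esp n)).contDiff.comp (h1.clm_comp contDiff_const)
  dV_spec := fun p k => inner_sharp _ _
  bV := by
    intro j hj
    obtain ⟨C, hC⟩ := h.subquadV (j + 1) (by omega) 1 one_pos
    refine ⟨C, fun s hs x => ?_⟩
    have hVs : ContDiff ℝ (⊤ : ℕ∞) (V s) :=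
      h.smoothV.comp (contDiff_const.prodMk contDiff_id)
    have e : ∀ y, (fderiv ℝ (fun p : ℝ × Esp n => V p.1 p.2) (s, y)).comp
      (ContinuousLinearMap.inr ℝ ℝ (Esp n)) = fderiv ℝ (V s) y := fun y =>
      (((h.smoothV.differentiable (by simp)) (s, y)).hasFDerivAt.comp y
        (hasFDerivAt_prodMk_right s y)).fderiv.symm
    have := sharp_bound hVs j (hC s hs x)
    simp only [← e] at this
    exact this
  φ := φ0
  hφ := h.smoothφ0
  dφ := fun x => sharp (Esp n) (fderiv ℝ φ0 x)
  dφ_spec := fun x k => inner_sharp _ _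
  bφ := by
    refine ⟨fun _ => ?_, fun k hk => ?_⟩
    · have h2 : ContDiff ℝ (⊤ : ℕ∞) (fderiv ℝ φ0) := h.smoothφ0.fderiv_right (by simp)
      exact (sharp (Esp n)).contDiff.comp h2
    · obtain ⟨C, hC⟩ := h.subquadφ0 (k + 1) (by omega)
      exact ⟨C, fun _ x => sharp_bound h.smoothφ0 k (hC x)⟩

end Final


/-- **Lemma 1.2 (eikonal equation).** Under the geometrical assumption, there exist `T > 0`
and a unique smooth solution `φ_eik` on `[0,T] × ℝⁿ` of the eikonal equation
`∂_t φ_eik + (1/2)|∇φ_eik|² + V = 0`, `φ_eik(0,·) = φ0`; moreover this solution is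
subquadratic: all its spatial derivatives of order `≥ 2` are bounded on `[0,T] × ℝⁿ`. -/
theorem stmt0 {n : ℕ} (V : ℝ → Esp n → ℝ) (φ0 : Esp n → ℝ)
    (hgeom : GeomAssump n V φ0) :
    ∃ T > (0:ℝ), ∃ φeik : ℝ → Esp n → ℝ,
      IsEikSol V φ0 T φeik ∧
      SubquadSlab T φeik ∧
      ∀ ψ : ℝ → Esp n → ℝ, IsEikSol V φ0 T ψ →
        ∀ t ∈ Icc (0:ℝ) T, ∀ x, ψ t x = φeik t x := by
  let D := geomData V φ0 hgeom
  obtain ⟨T0, h0, -, γ, w, eγ, ew, sφ, dt, dx, hi, hb⟩ := D.exists_sol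
  have hsub : ∀ t ∈ Icc (0 : ℝ) (T0 / 2), t ∈ Ioo (-T0) T0 := fun t ht =>
    ⟨by linarith [ht.1], by linarith [ht.2]⟩
  refine ⟨T0 / 2, by linarith, fun t x => D.act t (γ t x) (w t x), ⟨?_, ?_, hi⟩, ?_, ?_⟩
  · exact sφ.mono (fun p hp => ⟨hsub _ hp.1, trivial⟩)
  · intro t ht x
    have e : D.V (t, x) = V t x := rfl
    rw [(dt t (hsub t ht) x).deriv, gdotR_eq, dx t (hsub t ht) x, sharp_innerSL, e]
    ring
  · intro k hk
    obtain ⟨C, hC⟩ := hb k hk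
    exact ⟨C, fun t ht x => hC t (hsub t ht) x⟩
  · intro ψ hψ t ht x
    refine D.unique (T := T0 / 2) (by linarith) hψ.smooth ?_ hψ.init ht (eγ t (hsub t ht) x) (ew t x)
    intro s hs y
    have := hψ.eq s hs y
    rw [gdotR_eq] at this
    exact this

end
end

section
/- Under the geometrical assumption, there exist T > 0 and C0 > 0 such that |det ∇_y x(t,y)| ≥ C0 for all (t,y) ∈ [0,T] × ℝ^n, where x(t,y) is the spatial component of the Hamiltonian flow; consequently, for each t ∈ [0,T] the map y ↦ x(t,y) is a bijection of ℝ^n. -/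
open MeasureTheory Real Filter Set

noncomputable section

open scoped NNReal in
lemma aux_lin_ode {G : Type*} [NormedAddCommGroup G] [NormedSpace ℝ G] [CompleteSpace G]
    (A : ℝ → G →L[ℝ] G) (hA : Continuous A) (K T : ℝ) (hK : 0 ≤ K) (hT : 0 ≤ T)
    (hAK : ∀ t ∈ Icc (0:ℝ) T, ‖A t‖ ≤ K) (w0 : G)
    (hsmall : K * (‖w0‖ + 1/2) * T ≤ 1/2) :
    ∃ w : ℝ → G, w 0 = w0 ∧ ∀ t ∈ Icc (0:ℝ) T,
      HasDerivWithinAt w (A t (w t)) (Icc 0 T) t ∧ ‖w t - w0‖ ≤ 1/2 := by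
  have hL : 0 ≤ K * (‖w0‖ + 1/2) := by positivity
  have hpl : IsPicardLindelof (fun t w => A t w) (tmin := 0) (tmax := T)
      ⟨0, left_mem_Icc.2 hT⟩ w0 (1/2 : ℝ≥0) 0 (NNReal.mk (K * (‖w0‖ + 1/2)) hL) (NNReal.mk K hK) := by
    refine ⟨fun t ht => ?_, fun x _ => ?_, fun t ht x hx => ?_, ?_⟩
    · exact ((A t).lipschitz.weaken (hAK t ht)).lipschitzOnWith
    · exact (hA.clm_apply continuous_const).continuousOn
    · have h1 : ‖x - w0‖ ≤ 1/2 := by simpa [dist_eq_norm] using hx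
      have h2 : ‖x‖ ≤ ‖w0‖ + 1/2 := by
        have := norm_le_norm_add_norm_sub' x w0
        linarith
      exact ((A t).le_of_opNorm_le (hAK t ht) x).trans (by
        change _ ≤ K * (‖w0‖ + 1/2)
        gcongr)
    · change K * (‖w0‖ + 1/2) * max (T - 0) (0 - 0) ≤ ((1/2 : ℝ≥0) : ℝ) - ((0:ℝ≥0) : ℝ)
      rw [sub_zero, sub_zero, max_eq_left hT]
      simpa using hsmall
  have hx : w0 ∈ Metric.closedBall w0 ((0 : ℝ≥0) : ℝ) := by simp
  obtain ⟨α, hα⟩ := ODE.FunSpace.exists_isFixedPt_next hpl hx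
  have hmem : ∀ t, α.compProj t ∈ Metric.closedBall w0 ((1/2 : ℝ≥0) : ℝ) :=
    fun t => α.compProj_mem_closedBall hpl.mul_max_le
  have heq : ∀ t ∈ Icc (0:ℝ) T, α.compProj t =
      ODE.picard (fun t w => A t w) 0 w0 α.compProj t := by
    intro t ht
    nth_rw 1 [← hα]
    rw [ODE.FunSpace.compProj_of_mem ht, ODE.FunSpace.next_apply]
  refine ⟨α.compProj, ?_, fun t ht => ⟨?_, ?_⟩⟩
  · rw [heq 0 (left_mem_Icc.2 hT)]; simp
  · refine (ODE.hasDerivWithinAt_picard_Icc (u := univ) (left_mem_Icc.2 hT) ?_ ?_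
      (fun _ _ => mem_univ _) w0 ht).congr heq (heq t ht)
    · have : Continuous (Function.uncurry fun t w => A t w) :=
        (hA.comp continuous_fst).clm_apply continuous_snd
      exact this.continuousOn
    · exact α.continuous_compProj.continuousOn
  · have := hmem t
    simpa [dist_eq_norm] using this

lemma aux_diff {E F : Type*} [NormedAddCommGroup E] [NormedSpace ℝ E]
    [NormedAddCommGroup F] [NormedSpace ℝ F] [CompleteSpace F]
    (v : ℝ → F → F) (v' : ℝ → F → F →L[ℝ] F) (K : ℝ) (hK : 0 < K)
    (hv : ∀ t ∈ Icc (0:ℝ) 1, ∀ x, HasFDerivAt (v t) (v' t x) x)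
    (hvK : ∀ t ∈ Icc (0:ℝ) 1, ∀ x, ‖v' t x‖ ≤ K)
    (hvL : ∀ t ∈ Icc (0:ℝ) 1, ∀ x x', ‖v' t x - v' t x'‖ ≤ K * ‖x - x'‖)
    (hvc : Continuous (fun p : ℝ × F => v' p.1 p.2))
    (W : ℝ → E → F) (hW : ∀ t y, HasDerivAt (fun s => W s y) (v t (W t y)) t)
    (P : E → E →L[ℝ] F) (hP : ∀ y, HasFDerivAt (W 0) (P y) y) (hPK : ∀ y, ‖P y‖ ≤ K) :
    ∃ T > (0:ℝ), ∀ t ∈ Icc (0:ℝ) T, ∀ y, ∃ D : E →L[ℝ] F,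
      HasFDerivAt (W t) D y ∧ ‖D - P y‖ ≤ 1/2 := by
  have hden : 0 < 2 * (K * (K + 1/2)) := by positivity
  set T : ℝ := min 1 (1 / (2 * (K * (K + 1/2)))) with hTdef
  have hT0 : 0 < T := lt_min one_pos (by positivity)
  have hT1 : T ≤ 1 := min_le_left _ _
  have hT2 : K * (K + 1/2) * T ≤ 1/2 := by
    have : T ≤ 1 / (2 * (K * (K + 1/2))) := min_le_right _ _
    rw [le_div_iff₀ hden] at this
    linarith
  refine ⟨T, hT0, fun t ht y => ?_⟩
  have h01 : ∀ s ∈ Ico (0:ℝ) T, s ∈ Icc (0:ℝ) 1 := fun s hs => ⟨hs.1, hs.2.le.trans hT1⟩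
  have hWc : ∀ y, Continuous (fun s => W s y) := fun y =>
    continuous_iff_continuousAt.2 fun s => (hW s y).continuousAt
  have hac : Continuous (fun s => v' s (W s y)) := hvc.comp (continuous_id.prodMk (hWc y))
  -- linearised equation
  obtain ⟨w, hw0, hw⟩ := aux_lin_ode (fun s => ContinuousLinearMap.compL ℝ E F F (v' s (W s y)))
    ((ContinuousLinearMap.compL ℝ E F F).continuous.comp hac) K T hK.le hT0.le
    (fun s hs => by
      refine (ContinuousLinearMap.opNorm_le_bound _ hK.le fun B => ?_)
      exact (ContinuousLinearMap.opNorm_comp_le _ _).trans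
        (mul_le_mul_of_nonneg_right (hvK s ⟨hs.1, hs.2.trans hT1⟩ _) (norm_nonneg _)))
    (P y) (le_trans (by have := hPK y; gcongr) hT2)
  refine ⟨w t, ?_, (hw t ht).2⟩
  set KK : NNReal := NNReal.mk K hK.le with hKK
  have hKKe : (KK:ℝ) = K := rfl
  have hlip : ∀ s ∈ Icc (0:ℝ) 1, LipschitzWith KK (v s) := fun s hs =>
    lipschitzWith_of_nnnorm_fderiv_le (fun x => (hv s hs x).differentiableAt)
      (fun x => by rw [(hv s hs x).fderiv]; exact hvK s hs x)
  have hP0 : LipschitzWith KK (W 0) :=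
    lipschitzWith_of_nnnorm_fderiv_le (fun x => (hP x).differentiableAt)
      (fun x => by rw [(hP x).fderiv]; exact hPK x)
  set M : ℝ := K * exp K with hM
  have hM0 : 0 < M := by positivity
  have hdist : ∀ y', ∀ s ∈ Icc (0:ℝ) T, ‖W s y' - W s y‖ ≤ M * ‖y' - y‖ := by
    intro y' s hs
    have := dist_le_of_trajectories_ODE_of_mem (v := v) (s := fun _ => univ) (K := KK)
      (f := fun s => W s y') (g := fun s => W s y) (a := 0) (b := T) (δ := K * ‖y' - y‖)
      (fun s hs => (hlip s (h01 s hs)).lipschitzOnWith) (hWc y').continuousOn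
      (fun s _ => (hW s y').hasDerivWithinAt) (fun _ _ => mem_univ _) (hWc y).continuousOn
      (fun s _ => (hW s y).hasDerivWithinAt) (fun _ _ => mem_univ _)
      (by simpa [dist_eq_norm, hKKe] using hP0.dist_le_mul y' y) s hs
    rw [dist_eq_norm] at this
    refine this.trans ?_
    have h1 : exp ((KK:ℝ) * (s - 0)) ≤ exp K := by
      apply Real.exp_le_exp.2
      change K * (s - 0) ≤ K
      nlinarith [hs.2, hs.1]
    calc K * ‖y' - y‖ * exp ((KK:ℝ) * (s - 0)) ≤ K * ‖y' - y‖ * exp K := by gcongr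
      _ = _ := by rw [hM]; ring
  have hrem : ∀ s ∈ Icc (0:ℝ) 1, ∀ x x', ‖v s x' - v s x - v' s x (x' - x)‖ ≤
      K * ‖x' - x‖ * ‖x' - x‖ := by
    intro s hs x x'
    refine (convex_closedBall x ‖x' - x‖).norm_image_sub_le_of_norm_hasFDerivWithin_le'
      (f := v s) (f' := v' s) (fun z _ => (hv s hs z).hasFDerivWithinAt) (fun z hz => ?_)
      (Metric.mem_closedBall_self (norm_nonneg _)) (by simp [dist_eq_norm])
    refine (hvL s hs z x).trans ?_
    have : ‖z - x‖ ≤ ‖x' - x‖ := by simpa [dist_eq_norm] using hz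
    gcongr
  have key : ∀ y', ‖W t y' - W t y - w t (y' - y)‖ ≤
      ‖W 0 y' - W 0 y - P y (y' - y)‖ * exp (K * t) +
        K * (M * ‖y' - y‖) * (M * ‖y' - y‖) / K * (exp (K * t) - 1) := by
    intro y'
    have := dist_le_of_approx_trajectories_ODE_of_mem (v := fun s => v' s (W s y))
      (s := fun _ => univ) (K := KK)
      (f := fun s => W s y' - W s y) (f' := fun s => v s (W s y') - v s (W s y))
      (g := fun s => w s (y' - y)) (g' := fun s => v' s (W s y) (w s (y' - y)))
      (a := 0) (b := T) (δ := ‖W 0 y' - W 0 y - P y (y' - y)‖)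
      (εf := K * (M * ‖y' - y‖) * (M * ‖y' - y‖)) (εg := 0)
      (fun s hs => ((v' s (W s y)).lipschitz.weaken (hvK s (h01 s hs) _)).lipschitzOnWith)
      ((hWc y').sub (hWc y)).continuousOn
      (fun s _ => ((hW s y').sub (hW s y)).hasDerivWithinAt)
      (fun s hs => by
        rw [dist_eq_norm]
        refine (hrem s (h01 s hs) _ _).trans ?_
        have := hdist y' s (Ico_subset_Icc_self hs)
        gcongr)
      (fun _ _ => mem_univ _)
      (fun s hs => (((hw s hs).1.clm_apply (hasDerivWithinAt_const _ _ _)).continuousWithinAt))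
      (fun s hs => by
        have h := (hw s (Ico_subset_Icc_self hs)).1.clm_apply
          (hasDerivWithinAt_const s (Icc 0 T) (y' - y))
        have h2 := HasDerivWithinAt.mono_of_mem_nhdsWithin h (Icc_mem_nhdsGE_of_mem hs)
        simpa using h2)
      (fun s _ => by simp)
      (fun _ _ => mem_univ _)
      (by rw [hw0, dist_eq_norm]) t ht
    rw [hKKe, dist_eq_norm, gronwallBound_of_K_ne_0 hK.ne'] at this
    simpa using this
  rw [hasFDerivAt_iff_isLittleO]
  have hP' := hasFDerivAt_iff_isLittleO.1 (hP y)
  have hsq : (fun y' => ‖y' - y‖ * ‖y' - y‖) =o[nhds y] (fun y' => y' - y) := by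
    have h1 : (fun y' => ‖y' - y‖) =o[nhds y] (fun _ => (1:ℝ)) := by
      rw [Asymptotics.isLittleO_one_iff]
      have : Continuous fun y' => ‖y' - y‖ := by fun_prop
      simpa using this.tendsto y
    have h2 : (fun y' => ‖y' - y‖) =O[nhds y] (fun y' => ‖y' - y‖) := Asymptotics.isBigO_refl _ _
    have := h1.mul_isBigO h2
    simp only [one_mul] at this
    exact this.of_norm_right
  have hsum := (hP'.norm_left.const_mul_left (exp (K * t))).add
    (hsq.const_mul_left (M * M * (exp (K * t) - 1)))
  refine (Asymptotics.IsBigO.of_bound 1 (Eventually.of_forall fun y' => ?_)).trans_isLittleO hsum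
  rw [one_mul]
  refine ((key y').trans (le_of_eq ?_)).trans (le_abs_self _)
  field_simp

lemma aux_det (n : ℕ) : ∃ C0 > (0:ℝ), ∀ D : Esp n →L[ℝ] Esp n, ‖D - ContinuousLinearMap.id ℝ _‖ ≤ 1/2 →
    C0 ≤ |LinearMap.det (D : Esp n →ₗ[ℝ] Esp n)| := by
  have hc : IsCompact (Metric.closedBall (ContinuousLinearMap.id ℝ (Esp n)) (1/2)) :=
    isCompact_closedBall _ _
  have hcont : Continuous fun D : Esp n →L[ℝ] Esp n => |LinearMap.det (D : Esp n →ₗ[ℝ] Esp n)| :=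
    ContinuousLinearMap.continuous_det.abs
  obtain ⟨D0, hD0, hmin⟩ := hc.exists_isMinOn ⟨_, Metric.mem_closedBall_self (by norm_num)⟩
    hcont.continuousOn
  refine ⟨_, ?_, fun D hD => hmin (a := D) (by simpa [dist_eq_norm] using hD)⟩
  rw [gt_iff_lt, abs_pos]
  have hinj : Function.Injective (D0 : Esp n →ₗ[ℝ] Esp n) := by
    rw [← LinearMap.ker_eq_bot, LinearMap.ker_eq_bot']
    intro x hx
    have h1 : ‖D0 - ContinuousLinearMap.id ℝ _‖ ≤ 1/2 := by simpa [dist_eq_norm] using hD0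
    have h2 := (D0 - ContinuousLinearMap.id ℝ _).le_of_opNorm_le h1 x
    have h3 : D0 x = 0 := hx
    simp only [sub_apply, h3, ContinuousLinearMap.id_apply, zero_sub,
      norm_neg] at h2
    exact norm_le_zero_iff.1 (by linarith)
  have hu : IsUnit (D0 : Esp n →ₗ[ℝ] Esp n) := by
    rw [Module.End.isUnit_iff]
    exact ⟨hinj, LinearMap.injective_iff_surjective.1 hinj⟩
  exact ((LinearMap.isUnit_iff_isUnit_det _).1 hu).ne_zero

lemma aux_bij {n : ℕ} (f : Esp n → Esp n)
    (hf : ∀ y, ∃ D : Esp n →L[ℝ] Esp n, HasFDerivAt f D y ∧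
      ‖D - ContinuousLinearMap.id ℝ _‖ ≤ 1/2) : Function.Bijective f := by
  choose D hD hb using hf
  have happ : ApproximatesLinearOn f
      ((ContinuousLinearEquiv.refl ℝ (Esp n) : Esp n ≃L[ℝ] Esp n) : Esp n →L[ℝ] Esp n)
      univ (1/2 : NNReal) := by
    intro x _ y _
    have := convex_univ.norm_image_sub_le_of_norm_hasFDerivWithin_le'
      (f := f) (f' := D) (φ := ContinuousLinearMap.id ℝ _) (C := 1/2)
      (fun z _ => (hD z).hasFDerivWithinAt) (fun z _ => hb z) (mem_univ y) (mem_univ x)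
    simpa using this
  have hc : Subsingleton (Esp n) ∨ (1/2 : NNReal) <
      ‖((ContinuousLinearEquiv.refl ℝ (Esp n)).symm : Esp n →L[ℝ] Esp n)‖₊⁻¹ := by
    rcases subsingleton_or_nontrivial (Esp n) with h | h
    · exact Or.inl h
    · right
      have : ‖((ContinuousLinearEquiv.refl ℝ (Esp n)).symm : Esp n →L[ℝ] Esp n)‖₊ = 1 := by
        ext
        exact ContinuousLinearMap.norm_id
      rw [this, inv_one]
      exact NNReal.half_lt_self one_ne_zero
  exact ⟨injOn_univ.1 (happ.injOn hc), happ.surjective hc⟩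

/-- Riesz isometry, as a real-linear isometry. -/
def auxRiesz (n : ℕ) : (Esp n →L[ℝ] ℝ) ≃ₗᵢ[ℝ] Esp n :=
  { toFun := fun l => (InnerProductSpace.toDual ℝ (Esp n)).symm l
    invFun := fun x => InnerProductSpace.toDual ℝ (Esp n) x
    map_add' := fun a b => by simp
    map_smul' := fun c a => by simp
    left_inv := fun a => by simp
    right_inv := fun a => by simp
    norm_map' := fun a => by simp }

lemma aux_grad {n : ℕ} (f : Esp n → ℝ) : gradient f = auxRiesz n ∘ fderiv ℝ f := rfl

lemma aux_grad_norm {n : ℕ} (f : Esp n → ℝ) (k : ℕ) (x : Esp n) :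
    ‖iteratedFDeriv ℝ k (gradient f) x‖ = ‖iteratedFDeriv ℝ (k+1) f x‖ := by
  rw [aux_grad, LinearIsometryEquiv.norm_iteratedFDeriv_comp_left, norm_iteratedFDeriv_fderiv]

lemma aux_grad_norm1 {n : ℕ} (f : Esp n → ℝ) (x : Esp n) :
    ‖fderiv ℝ (gradient f) x‖ = ‖iteratedFDeriv ℝ 2 f x‖ := by
  rw [← norm_iteratedFDeriv_one, aux_grad_norm]

lemma aux_grad_norm2 {n : ℕ} (f : Esp n → ℝ) (x : Esp n) :
    ‖fderiv ℝ (fderiv ℝ (gradient f)) x‖ = ‖iteratedFDeriv ℝ 3 f x‖ := by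
  rw [← norm_iteratedFDeriv_one, norm_iteratedFDeriv_fderiv, aux_grad_norm]

lemma aux_grad_smooth {n : ℕ} (V : ℝ → Esp n → ℝ)
    (h : ContDiff ℝ (⊤ : ℕ∞) (fun p : ℝ × Esp n => V p.1 p.2)) :
    ContDiff ℝ (⊤ : ℕ∞) (fun p : ℝ × Esp n => gradient (V p.1) p.2) := by
  have h1 : ContDiff ℝ (⊤ : ℕ∞) (fun p : ℝ × Esp n => fderiv ℝ (V p.1) p.2) := by
    refine ContDiff.fderiv (f := fun p : ℝ × Esp n => V p.1) (m := (⊤:ℕ∞)) (n := (⊤:ℕ∞)) ?_ contDiff_snd (by simp)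
    exact h.comp ((contDiff_fst.comp contDiff_fst).prodMk contDiff_snd)
  exact (auxRiesz n).contDiff.comp h1

lemma aux_fderiv_smooth {n : ℕ} (g : ℝ → Esp n → Esp n)
    (h : ContDiff ℝ (⊤ : ℕ∞) (fun p : ℝ × Esp n => g p.1 p.2)) :
    ContDiff ℝ (⊤ : ℕ∞) (fun p : ℝ × Esp n => fderiv ℝ (g p.1) p.2) := by
  refine ContDiff.fderiv (f := fun p : ℝ × Esp n => g p.1) (m := (⊤:ℕ∞)) (n := (⊤:ℕ∞)) ?_ contDiff_snd (by simp)
  exact h.comp ((contDiff_fst.comp contDiff_fst).prodMk contDiff_snd)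

/-- Under the geometrical assumption, there exist `T > 0` and `C0 > 0` such that the
Jacobian determinant of the flow map `y ↦ x(t,y)` is bounded below by `C0` in absolute
value for `(t,y) ∈ [0,T] × ℝⁿ`; consequently `y ↦ x(t,y)` is a bijection of `ℝⁿ` for
each `t ∈ [0,T]`. -/
theorem stmt4 {n : ℕ} (V : ℝ → Esp n → ℝ) (φ0 : Esp n → ℝ)
    (hgeom : GeomAssump n V φ0)
    (X Ξ : ℝ → Esp n → Esp n) (hflow : IsHamFlow V φ0 X Ξ) :
    ∃ T > (0:ℝ), ∃ C0 > (0:ℝ),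
      (∀ t ∈ Icc (0:ℝ) T, ∀ y, C0 ≤ |jacDet (X t) y|) ∧
      ∀ t ∈ Icc (0:ℝ) T, Function.Bijective (X t) := by
  obtain ⟨C2, hC2⟩ := hgeom.subquadV 2 le_rfl 1 one_pos
  obtain ⟨C3, hC3⟩ := hgeom.subquadV 3 (by norm_num) 1 one_pos
  obtain ⟨B, hB⟩ := hgeom.subquadφ0 2 le_rfl
  set K : ℝ := max 1 (max C2 (max C3 B)) with hKdef
  have hK1 : 1 ≤ K := le_max_left _ _
  have hKC2 : C2 ≤ K := (le_max_left _ _).trans (le_max_right _ _)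
  have hKC3 : C3 ≤ K :=
    (le_max_left _ _).trans ((le_max_right _ _).trans (le_max_right _ _))
  have hKB : B ≤ K :=
    (le_max_right _ _).trans ((le_max_right _ _).trans (le_max_right _ _))
  have hK0 : 0 < K := by linarith
  have habs : ∀ t ∈ Icc (0:ℝ) 1, |t| ≤ 1 := fun t ht => by
    rw [abs_of_nonneg ht.1]; exact ht.2
  have hG := aux_grad_smooth V hgeom.smoothV
  have hG' := aux_fderiv_smooth (fun t => gradient (V t)) hG
  have hGt : ∀ t, ContDiff ℝ (⊤ : ℕ∞) (gradient (V t)) := fun t =>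
    hG.comp (contDiff_const.prodMk contDiff_id)
  have hGt' : ∀ t, ContDiff ℝ (⊤ : ℕ∞) (fderiv ℝ (gradient (V t))) := fun t =>
    hG'.comp (contDiff_const.prodMk contDiff_id)
  have hφ : ContDiff ℝ (⊤ : ℕ∞) (gradient φ0) := by
    have := aux_grad_smooth (fun _ => φ0) (hgeom.smoothφ0.comp contDiff_snd)
    exact this.comp (contDiff_const (c := (0:ℝ)).prodMk contDiff_id)
  have htop : ((⊤ : ℕ∞) : WithTop ℕ∞) ≠ 0 := by simp
  obtain ⟨T, hT, hD⟩ := aux_diff (E := Esp n) (F := Esp n × Esp n)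
    (fun t p => (p.2, -gradient (V t) p.1))
    (fun t p => (ContinuousLinearMap.snd ℝ (Esp n) (Esp n)).prod
      (-((fderiv ℝ (gradient (V t)) p.1).comp (ContinuousLinearMap.fst ℝ (Esp n) (Esp n)))))
    K hK0
    (fun t _ p => by
      refine (hasFDerivAt_snd (𝕜 := ℝ) (p := p)).prodMk ?_
      have h1 : HasFDerivAt (gradient (V t)) (fderiv ℝ (gradient (V t)) p.1) p.1 :=
        ((hGt t).differentiable htop _).hasFDerivAt
      exact (h1.comp p hasFDerivAt_fst).neg)
    (fun t ht p => by
      refine ContinuousLinearMap.opNorm_le_bound _ hK0.le fun q => ?_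
      have h1 : ‖fderiv ℝ (gradient (V t)) p.1‖ ≤ K := by
        rw [aux_grad_norm1]; exact (hC2 t (habs t ht) _).trans hKC2
      refine max_le ?_ ?_
      · change ‖q.2‖ ≤ _
        have := norm_snd_le q
        nlinarith [norm_nonneg q]
      · change ‖-(fderiv ℝ (gradient (V t)) p.1 q.1)‖ ≤ _
        rw [norm_neg]
        refine (ContinuousLinearMap.le_of_opNorm_le _ h1 _).trans ?_
        have := norm_fst_le q
        gcongr)
    (fun t ht p p' => by
      refine ContinuousLinearMap.opNorm_le_bound _ (by positivity) fun q => ?_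
      have h1 : ‖fderiv ℝ (gradient (V t)) p.1 - fderiv ℝ (gradient (V t)) p'.1‖ ≤
          K * ‖p.1 - p'.1‖ := by
        refine convex_univ.norm_image_sub_le_of_norm_fderiv_le (𝕜 := ℝ)
          (fun z _ => (hGt' t).differentiable htop z) (fun z _ => ?_) (mem_univ _) (mem_univ _)
        rw [aux_grad_norm2]; exact (hC3 t (habs t ht) _).trans hKC3
      refine max_le ?_ ?_
      · change ‖q.2 - q.2‖ ≤ _
        rw [sub_self, norm_zero]
        positivity
      · change ‖-(fderiv ℝ (gradient (V t)) p.1 q.1) - -(fderiv ℝ (gradient (V t)) p'.1 q.1)‖ ≤ _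
        rw [neg_sub_neg, norm_sub_rev, ← _root_.sub_apply]
        refine (ContinuousLinearMap.le_of_opNorm_le _ h1 _).trans ?_
        have := norm_fst_le q
        have := norm_fst_le (p - p')
        rw [Prod.fst_sub] at this
        gcongr)
    (by
      have h1 : Continuous fun p : ℝ × (Esp n × Esp n) => fderiv ℝ (gradient (V p.1)) p.2.1 :=
        hG'.continuous.comp (continuous_fst.prodMk (continuous_fst.comp continuous_snd))
      have h2 : Continuous fun p : ℝ × (Esp n × Esp n) =>
          -((fderiv ℝ (gradient (V p.1)) p.2.1).comp
            (ContinuousLinearMap.fst ℝ (Esp n) (Esp n))) :=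
        (h1.clm_comp continuous_const).neg
      exact (ContinuousLinearMap.prodₗᵢ (𝕜 := ℝ) (E := Esp n × Esp n) (F := Esp n) (G := Esp n)
        ℝ).continuous.comp (continuous_const.prodMk h2))
    (fun t y => (X t y, Ξ t y))
    (fun t y => (hflow.dx t y).prodMk (hflow.dxi t y))
    (fun y => (ContinuousLinearMap.id ℝ (Esp n)).prod (fderiv ℝ (gradient φ0) y))
    (fun y => by
      have h0 : (fun y => (X 0 y, Ξ 0 y)) = fun y => (y, gradient φ0 y) := by
        funext y; rw [hflow.init_x, hflow.init_xi]
      rw [h0]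
      exact (hasFDerivAt_id y).prodMk (hφ.differentiable htop y).hasFDerivAt)
    (fun y => by
      refine ContinuousLinearMap.opNorm_le_bound _ hK0.le fun q => ?_
      have h1 : ‖fderiv ℝ (gradient φ0) y‖ ≤ K := by
        rw [aux_grad_norm1]; exact (hB _).trans hKB
      refine max_le ?_ ?_
      · change ‖q‖ ≤ _
        nlinarith [norm_nonneg q]
      · exact ContinuousLinearMap.le_of_opNorm_le _ h1 _)
  have hX : ∀ t ∈ Icc (0:ℝ) T, ∀ y, ∃ D : Esp n →L[ℝ] Esp n, HasFDerivAt (X t) D y ∧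
      ‖D - ContinuousLinearMap.id ℝ _‖ ≤ 1/2 := by
    intro t ht y
    obtain ⟨D, hD1, hD2⟩ := hD t ht y
    refine ⟨(ContinuousLinearMap.fst ℝ (Esp n) (Esp n)).comp D, hD1.fst, ?_⟩
    refine ContinuousLinearMap.opNorm_le_bound _ (by norm_num) fun q => ?_
    refine le_trans ?_ (ContinuousLinearMap.le_of_opNorm_le _ hD2 q)
    exact norm_fst_le ((D - (ContinuousLinearMap.id ℝ (Esp n)).prod
      (fderiv ℝ (gradient φ0) y)) q)
  obtain ⟨C0, hC0, hdet⟩ := aux_det n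
  refine ⟨T, hT, C0, hC0, fun t ht y => ?_, fun t ht => aux_bij _ (hX t ht)⟩
  obtain ⟨D, hD1, hD2⟩ := hX t ht y
  rw [jacDet, hD1.fderiv]
  exact hdet D hD2

end
end
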